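/- arXiv:math/0311290 — 3 statements merged into one kernel-verified Lean document; each statement's English description precedes it below -/
import Mathlib

section
/- Let H be a subgroup of a finite group G and let η be the representation of G induced from the trivial representation of H (the permutation representation of G on the cosets of H). Then for all λ, ρ ∈ Irr(G), L_η(λ,ρ) = (|H|/|G|)·(dim(ρ)/dim(λ))·Σ_{τ∈Irr(H)} κ(τ,λ)·κ(τ,ρ). -/
open CategoryTheory Finset

namespace SteinRep

/-- The inner product `⟨φ, ψ⟩ = |G|⁻¹ Σ_g φ(g) conj(ψ(g))` on functions on a finite group. -/
noncomputable def innerCF (G : Type) [Fintype G] (φ ψ : G → ℂ) : ℂ :=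
  (Fintype.card G : ℂ)⁻¹ * ∑ g : G, φ g * (starRingEnd ℂ) (ψ g)

/-- The dimension of a finite dimensional representation. -/
noncomputable def dimC {G : Type} [Group G] (X : FDRep ℂ G) : ℕ := Module.finrank ℂ X

/-- The Plancherel measure `π(λ) = dim(λ)²/|G|`. -/
noncomputable def plancherel {G : Type} [Group G] [Fintype G] (X : FDRep ℂ G) : ℂ :=
  (dimC X : ℂ) ^ 2 / (Fintype.card G : ℂ)

/-- The transition quantity `L_η(λ,ρ) = (dim ρ/(dim η · dim λ)) ⟨χ^ρ, χ^η χ^λ⟩`. -/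
noncomputable def L {G : Type} [Group G] [Fintype G] (η X Y : FDRep ℂ G) : ℂ :=
  (dimC Y : ℂ) / ((dimC η : ℂ) * (dimC X : ℂ)) *
    innerCF G Y.character (fun g => η.character g * X.character g)


/-- The multiplicity `κ(τ,ρ) = ⟨χ^τ, Res_H χ^ρ⟩_H`. -/
noncomputable def kappa {G : Type} [Group G] (H : Subgroup G) [Fintype H]
    (T : FDRep ℂ H) (X : FDRep ℂ G) : ℂ :=
  innerCF H T.character (fun h => X.character (h : G))

open scoped Matrix ComplexOrder in
theorem conj_character {G : Type} [Group G] [Finite G] (X : FDRep ℂ G) (g : G) :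
    (starRingEnd ℂ) (X.character g) = X.character g⁻¹ := by
  classical
  have := Fintype.ofFinite G
  let b := Module.finBasis ℂ X
  let A : G →* Matrix _ _ ℂ := ((LinearMap.toMatrixAlgEquiv b).toMulEquiv.toMonoidHom).comp X.ρ
  have trace_A (x : G) : X.character x = (A x).trace :=
    LinearMap.trace_eq_matrix_trace ℂ b (X.ρ x)
  let P : Matrix _ _ ℂ := ∑ x : G, (A x)ᴴ * A x
  have hP : P.PosDef := by
    have hsplit : P = (A 1)ᴴ * A 1 + ∑ x ∈ univ.erase 1, (A x)ᴴ * A x :=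
      (add_sum_erase _ _ (mem_univ 1)).symm
    rw [hsplit, map_one, Matrix.conjTranspose_one, one_mul]
    exact Matrix.PosDef.one.add_posSemidef
      (Matrix.posSemidef_sum _ fun x _ => Matrix.posSemidef_conjTranspose_mul_self (A x))
  have hdet : IsUnit P.det := (Matrix.isUnit_iff_isUnit_det P).mp hP.isUnit
  have hinv : (A g)ᴴ * P * A g = P := by
    simp only [P, mul_sum, sum_mul]
    refine Fintype.sum_equiv (Equiv.mulRight g) _ _ fun x => ?_
    simp [mul_assoc]
  have hstar : (A g)ᴴ = P * A g⁻¹ * P⁻¹ := by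
    have hcomm : (A g)ᴴ * P = P * A g⁻¹ := by
      calc (A g)ᴴ * P = (A g)ᴴ * P * (A g * A g⁻¹) := by
            rw [← map_mul, mul_inv_cancel, map_one, mul_one]
        _ = (A g)ᴴ * P * A g * A g⁻¹ := (mul_assoc _ _ _).symm
        _ = P * A g⁻¹ := by rw [hinv]
    rw [← hcomm, Matrix.mul_nonsing_inv_cancel_right _ _ hdet]
  rw [trace_A, trace_A, starRingEnd_apply, ← Matrix.trace_conjTranspose, hstar,
    Matrix.trace_mul_comm, Matrix.nonsing_inv_mul_cancel_left _ _ hdet]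

theorem innerCF_character_simple {G : Type} [Group G] [Fintype G] (X Y : FDRep ℂ G)
    [Simple X] [Simple Y] [Decidable (Nonempty (X ≅ Y))] :
    innerCF G X.character Y.character = if Nonempty (X ≅ Y) then 1 else 0 := by
  have : Invertible (Nat.card G : ℂ) := invertibleOfNonzero (NeZero.ne _)
  have h := FDRep.char_orthonormal X Y
  rw [Nat.card_eq_fintype_card] at h
  simp only [innerCF, conj_character]
  rw [h]
  congr

theorem simple_of_isIrreducible {G : Type} [Group G] [Finite G] {V : Type} [AddCommGroup V]
    [Module ℂ V] [FiniteDimensional ℂ V] (ρ : Representation ℂ G V) [ρ.IsIrreducible] :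
    Simple (FDRep.of ρ) := by
  have := Fintype.ofFinite G
  have : Invertible (Nat.card G : ℂ) := invertibleOfNonzero (NeZero.ne _)
  rw [FDRep.simple_iff_char_is_norm_one]
  have h := Representation.char_orthonormal ρ ρ
  rw [if_pos ⟨Representation.Equiv.refl ρ⟩, inv_mul_eq_one₀ (NeZero.ne _)] at h
  exact h.symm

theorem character_eq_add_of_isCompl {G V : Type} [Group G] [AddCommGroup V] [Module ℂ V]
    [FiniteDimensional ℂ V] {ρ : Representation ℂ G V} {a b : Subrepresentation ρ}
    (h : IsCompl a.toSubmodule b.toSubmodule) (g : G) :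
    ρ.character g = a.toRepresentation.character g + b.toRepresentation.character g := by
  unfold Representation.character
  rw [← LinearMap.trace_prodMap', ← LinearMap.trace_conj' _ (Submodule.prodEquivOfIsCompl _ _ h)]
  congr 1
  ext x
  obtain ⟨y, rfl⟩ := (Submodule.prodEquivOfIsCompl _ _ h).surjective x
  simp [LinearEquiv.conj_apply, Subrepresentation.toRepresentation]

theorem exists_character_eq_sum {G : Type} [Group G] [Finite G] {ι : Type} [Fintype ι]
    (V : ι → FDRep ℂ G) (hcomplete : ∀ X : FDRep ℂ G, Simple X → ∃ i, Nonempty (X ≅ V i))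
    (n : ℕ) : ∀ {W : Type} [AddCommGroup W] [Module ℂ W] [FiniteDimensional ℂ W]
      (ρ : Representation ℂ G W), Module.finrank ℂ W = n →
      ∃ m : ι → ℕ, ∀ g, ρ.character g = ∑ i, (m i : ℂ) * (V i).character g := by
  classical
  induction n using Nat.strong_induction_on with
  | _ n ih =>
    intro W _ _ _ ρ hn
    cases subsingleton_or_nontrivial W with
    | inl hW =>
      refine ⟨0, fun g => ?_⟩
      have h0 : ρ g = 0 := Subsingleton.elim _ _
      simp [Representation.character, h0]
    | inr hW =>
      by_cases hρ : ρ.IsIrreducible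
      · obtain ⟨i, ⟨e⟩⟩ := hcomplete _ (simple_of_isIrreducible ρ)
        refine ⟨Pi.single i 1, fun g => ?_⟩
        simpa [Pi.single_apply] using! congrFun (FDRep.char_iso e) g
      · have : ρ.IsSemisimpleRepresentation := by
          rw [Representation.isSemisimpleRepresentation_iff_isSemisimpleModule_asModule]
          infer_instance
        obtain ⟨a, ha, ha'⟩ : ∃ a : Subrepresentation ρ, a ≠ ⊥ ∧ a ≠ ⊤ := by
          by_contra! h
          have : Nontrivial (Subrepresentation ρ) :=
            ⟨⊥, ⊤, fun h => bot_ne_top (congrArg (·.toSubmodule) h : (⊥ : Submodule ℂ W) = ⊤)⟩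
          exact hρ ⟨fun a => or_iff_not_imp_left.mpr (h a)⟩
        obtain ⟨b, hab⟩ := exists_isCompl a
        have hab' : IsCompl a.toSubmodule b.toSubmodule :=
          ⟨disjoint_iff.mpr (congrArg (·.toSubmodule) hab.inf_eq_bot),
            codisjoint_iff.mpr (congrArg (·.toSubmodule) hab.sup_eq_top)⟩
        have hadd := Submodule.finrank_add_eq_of_isCompl hab'
        have ha_lt := Submodule.finrank_lt
          (fun h => ha' (Subrepresentation.toSubmodule_injective h) :
            a.toSubmodule ≠ ⊤)
        have ha_pos : Module.finrank ℂ a.toSubmodule ≠ 0 := fun h =>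
          ha (Subrepresentation.toSubmodule_injective
            (Submodule.finrank_eq_zero.mp h))
        obtain ⟨m₁, h₁⟩ := ih _ (by omega) a.toRepresentation rfl
        obtain ⟨m₂, h₂⟩ := ih (Module.finrank ℂ b.toSubmodule) (by omega) b.toRepresentation rfl
        refine ⟨m₁ + m₂, fun g => ?_⟩
        rw [character_eq_add_of_isCompl hab', h₁, h₂, ← sum_add_distrib]
        simp [add_mul]

theorem sum_innerCF_mul_innerCF {G : Type} [Group G] [Fintype G] {ι : Type} [Fintype ι]
    (V : ι → FDRep ℂ G) [∀ i, Simple (V i)]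
    (hdistinct : ∀ i j, Nonempty (V i ≅ V j) → i = j)
    {φ ψ : G → ℂ} {m n : ι → ℕ} (hφ : ∀ g, φ g = ∑ i, (m i : ℂ) * (V i).character g)
    (hψ : ∀ g, ψ g = ∑ i, (n i : ℂ) * (V i).character g) :
    ∑ i, innerCF G (V i).character φ * innerCF G (V i).character ψ = innerCF G ψ φ := by
  classical
  have horth (i j : ι) : innerCF G (V i).character (V j).character = if i = j then 1 else 0 := by
    rw [innerCF_character_simple]
    congr 1
    exact propext ⟨hdistinct i j, fun h => ⟨eqToIso (congrArg V h)⟩⟩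
  have hright {φ : G → ℂ} {m : ι → ℕ} (hφ : ∀ g, φ g = ∑ i, (m i : ℂ) * (V i).character g)
      (χ : G → ℂ) : innerCF G χ φ = ∑ j, (m j : ℂ) * innerCF G χ (V j).character := by
    simp only [innerCF, hφ, map_sum, map_mul, map_natCast, mul_sum]
    rw [sum_comm]
    exact sum_congr rfl fun _ _ => sum_congr rfl fun _ _ => by ring
  have hmult {φ : G → ℂ} {m : ι → ℕ} (hφ : ∀ g, φ g = ∑ i, (m i : ℂ) * (V i).character g)
      (i : ι) : innerCF G (V i).character φ = m i := by
    simp [hright hφ, horth]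
  have hleft : innerCF G ψ φ = ∑ i, (n i : ℂ) * innerCF G (V i).character φ := by
    simp only [innerCF, hψ, sum_mul, mul_sum]
    rw [sum_comm]
    exact sum_congr rfl fun _ _ => sum_congr rfl fun _ _ => by ring
  rw [hleft]
  exact sum_congr rfl fun i _ => by rw [hmult hφ, hmult hψ, mul_comm]

theorem sum_card_fixedPoints_mul {G : Type} [Group G] [Fintype G] (H : Subgroup G) [Fintype H]
    [Fintype (G ⧸ H)] [DecidableEq (G ⧸ H)] (f : G → ℂ) (hf : ∀ a g, f (a * g * a⁻¹) = f g) :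
    ∑ g, (Fintype.card {x : G ⧸ H // g • x = x} : ℂ) * f g =
      Fintype.card (G ⧸ H) * ∑ h : H, f h := by
  classical
  have hcoset (x : G ⧸ H) : ∑ g, (if g • x = x then f g else 0) = ∑ h : H, f h := by
    induction x using QuotientGroup.induction_on with
    | H a =>
      rw [← Fintype.sum_equiv (MulAut.conj a).toEquiv (fun g => if g ∈ H then f g else 0) _ ?_]
      · rw [← sum_filter]
        exact (sum_subtype _ (by simp) f)
      · intro g
        have hfix : (MulAut.conj a g) • (a : G ⧸ H) = a ↔ g ∈ H := by
          rw [MulAut.conj_apply, eq_comm, MulAction.Quotient.smul_coe, QuotientGroup.eq]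
          simp [mul_assoc]
        simp [← hfix, hf]
  simp only [Fintype.card_subtype, card_filter, Nat.cast_sum, sum_mul]
  rw [sum_comm]
  simp [hcoset]

/-- Proposition 1 of the paper: if `η` is the permutation representation of `G` on the
cosets of a subgroup `H` (characterized by its character `g ↦ #{x ∈ G/H : g x = x}`),
then `L_η(λ,ρ) = (|H|/|G|)(dim ρ/dim λ) Σ_{τ ∈ Irr(H)} κ(τ,λ) κ(τ,ρ)`.
Here `V` lists `Irr(G)` and `VH` lists `Irr(H)`. -/
theorem L_ind_eq_M {G : Type} [Group G] [Fintype G] [DecidableEq G]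
    (H : Subgroup G) [Fintype H] [Fintype (G ⧸ H)] [DecidableEq (G ⧸ H)]
    {ι : Type} [Fintype ι] (V : ι → FDRep ℂ G)
    (hsimple : ∀ i, Simple (V i))
    (hdistinct : ∀ i j, Nonempty (V i ≅ V j) → i = j)
    (hcomplete : ∀ X : FDRep ℂ G, Simple X → ∃ i, Nonempty (X ≅ V i))
    {ιH : Type} [Fintype ιH] (VH : ιH → FDRep ℂ H)
    (hsimpleH : ∀ t, Simple (VH t))
    (hdistinctH : ∀ t u, Nonempty (VH t ≅ VH u) → t = u)
    (hcompleteH : ∀ X : FDRep ℂ H, Simple X → ∃ t, Nonempty (X ≅ VH t))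
    (η : FDRep ℂ G)
    (hη : ∀ g : G, η.character g = (Fintype.card {x : G ⧸ H // g • x = x} : ℂ)) :
    ∀ i j, L η (V i) (V j) =
      (Fintype.card H : ℂ) / (Fintype.card G : ℂ) * ((dimC (V j) : ℂ) / (dimC (V i) : ℂ)) *
        ∑ t, kappa H (VH t) (V i) * kappa H (VH t) (V j) := by
  intro i j
  let f : G → ℂ := fun g => (V j).character g * (starRingEnd ℂ) ((V i).character g)
  have hdim : (dimC η : ℂ) = Fintype.card (G ⧸ H) := by
    rw [dimC, ← FDRep.char_one, hη]
    simp [Fintype.card_subtype]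
  have hL : innerCF G (V j).character (fun g => η.character g * (V i).character g) =
      (Fintype.card G : ℂ)⁻¹ * (Fintype.card (G ⧸ H) * ∑ h : H, f h) := by
    rw [← sum_card_fixedPoints_mul H f fun a g => by simp only [f, FDRep.char_conj], innerCF]
    congr 1
    refine sum_congr rfl fun g _ => ?_
    simp only [hη, map_mul, map_natCast, f]
    ring
  have hres (X : FDRep ℂ G) := exists_character_eq_sum VH hcompleteH _ (X.ρ.comp H.subtype) rfl
  obtain ⟨m, hm⟩ := hres (V i)
  obtain ⟨n, hn⟩ := hres (V j)
  have hM : ∑ t, kappa H (VH t) (V i) * kappa H (VH t) (V j) =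
      (Fintype.card H : ℂ)⁻¹ * ∑ h : H, f h :=
    sum_innerCF_mul_innerCF VH hdistinctH hm hn
  have hG : (Fintype.card (G ⧸ H) : ℂ) ≠ 0 := Nat.cast_ne_zero.mpr Fintype.card_ne_zero
  have hH : (Fintype.card H : ℂ) ≠ 0 := Nat.cast_ne_zero.mpr Fintype.card_ne_zero
  rw [L, hL, hM, hdim]
  field_simp

end SteinRep
end

section
/- Let η be a finite-dimensional complex representation of a finite group G whose character χ^η is real valued. For each conjugacy class C of G define ψ_C : Irr(G) → ℂ by ψ_C(ρ) = |C|^{1/2}·χ^ρ(C)/dim(ρ), where χ^ρ(C) is the common value of χ^ρ on C. Then: (1) for every conjugacy class C and every λ ∈ Irr(G), Σ_{ρ∈Irr(G)} L_η(λ,ρ)·ψ_C(ρ) = (χ^η(C)/dim(η))·ψ_C(λ), so ψ_C is an eigenfunction of L_η with eigenvalue χ^η(C)/dim(η); and (2) the functions ψ_C form an orthonormal basis of L²(π): for any conjugacy classes C, C', Σ_{ρ∈Irr(G)} π(ρ)·ψ_C(ρ)·conj(ψ_{C'}(ρ)) equals 1 if C = C' and 0 otherwise. -/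
open CategoryTheory Finset

namespace SteinRep

/-- The eigenfunction `ψ_C(ρ) = |C|^{1/2} χ^ρ(C)/dim ρ` attached to the conjugacy class of
`g`. -/
noncomputable def psiC {G : Type} [Group G] [Fintype G] (g : G) (X : FDRep ℂ G) : ℂ :=
  (Real.sqrt (Nat.card {h : G // IsConj g h}) : ℂ) * X.character g / (dimC X : ℂ)

section

open Representation

open scoped MonoidAlgebra

open scoped ComplexOrder in
/-- The character of a complex representation of a finite group satisfies
`χ(g⁻¹) = conj χ(g)`. -/
theorem character_inv {G : Type} [Group G] [Fintype G] (X : FDRep ℂ G) (g : G) :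
    X.character g⁻¹ = (starRingEnd ℂ) (X.character g) := by
  classical
  let b := Module.finBasis ℂ X
  let M : G → Matrix _ _ ℂ := fun h => LinearMap.toMatrix b b (X.ρ h)
  have hM : ∀ x y, M (x * y) = M x * M y := fun x y => by
    simp only [M, map_mul, LinearMap.toMatrix_mul]
  have hM1 : M 1 = 1 := by simp only [M, map_one, LinearMap.toMatrix_one]
  have hχ : ∀ h, X.character h = (M h).trace := fun h => by
    simp only [M, FDRep.character]
    exact LinearMap.trace_eq_matrix_trace ℂ b _
  let P : Matrix _ _ ℂ := ∑ h, (M h).conjTranspose * M h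
  have hP : P.PosDef := by
    have h1 : P = (M 1).conjTranspose * M 1 +
        ∑ h ∈ univ.erase 1, (M h).conjTranspose * M h :=
      (Finset.add_sum_erase univ _ (mem_univ (1 : G))).symm
    rw [h1, hM1]
    refine Matrix.PosDef.add_posSemidef ?_ ?_
    · simpa using Matrix.PosDef.one
    · exact Matrix.posSemidef_sum _ fun h _ => Matrix.posSemidef_conjTranspose_mul_self _
  have hinv : (M g).conjTranspose * P = P * M g⁻¹ := by
    simp only [P, Finset.mul_sum, Finset.sum_mul]
    refine Fintype.sum_equiv (Equiv.mulRight g) _ _ fun h => ?_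
    simp only [Equiv.coe_mulRight, hM, Matrix.conjTranspose_mul, mul_assoc]
    rw [← hM g, mul_inv_cancel, hM1, mul_one]
  have hu : IsUnit P.det := (Matrix.isUnit_iff_isUnit_det P).1 hP.isUnit
  have h2 : M g⁻¹ = P⁻¹ * ((M g).conjTranspose * P) := by
    rw [hinv, Matrix.nonsing_inv_mul_cancel_left _ _ hu]
  rw [hχ, hχ, h2, Matrix.trace_mul_comm, mul_assoc, Matrix.mul_nonsing_inv _ hu, mul_one,
    Matrix.trace_conjTranspose]
  rfl

/-- A class function whose pairing with an irreducible character vanishes acts by zero on the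
corresponding representation. -/
theorem sum_smul_eq_zero_of_isIrreducible {G : Type} [Group G] [Fintype G] {W : Type*}
    [AddCommGroup W] [Module ℂ W] [FiniteDimensional ℂ W] (ρ : Representation ℂ G W)
    [Representation.IsIrreducible ρ] (f : G → ℂ) (hf : ∀ g h, f (h * g * h⁻¹) = f g)
    (h0 : ∑ g, f g * ρ.character g = 0) : ∑ g, f g • ρ g = 0 := by
  let A : IntertwiningMap ρ ρ := ⟨∑ g, f g • ρ g, fun h => by
    change (∑ g, f g • ρ g) * ρ h = ρ h * ∑ g, f g • ρ g
    simp only [Finset.mul_sum, Finset.sum_mul, smul_mul_assoc, mul_smul_comm, ← map_mul]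
    refine Fintype.sum_equiv (MulAut.conj h⁻¹).toEquiv _ _ fun g => ?_
    have := hf g h⁻¹
    simp only [MulEquiv.toEquiv_eq_coe, MulEquiv.coe_toEquiv, MulAut.conj_apply, this]
    congr 2
    group⟩
  obtain ⟨c, hc⟩ :=
    (IsIrreducible.algebraMap_intertwiningMap_bijective_of_isAlgClosed (ρ := ρ)).surjective A
  have hc' : ∑ g, f g • ρ g = c • LinearMap.id := by
    change A.toLinearMap = _
    rw [← hc]
    rfl
  have ht := congrArg (LinearMap.trace ℂ W) hc'
  have : Nontrivial ρ.asModule := IsSimpleModule.nontrivial ℂ[G] ρ.asModule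
  have : Nontrivial W := this
  have hd : (Module.finrank ℂ W : ℂ) ≠ 0 := Nat.cast_ne_zero.2 Module.finrank_pos.ne'
  simp only [map_sum, map_smul, smul_eq_mul, LinearMap.trace_id] at ht
  have h0' : c * (Module.finrank ℂ W : ℂ) = 0 := ht.symm.trans h0
  rw [hc', (mul_eq_zero.1 h0').resolve_right hd, zero_smul]

/-- A class function orthogonal to all irreducible characters vanishes. -/
theorem classFunction_eq_zero {G : Type} [Group G] [Fintype G] {ι : Type}
    (V : ι → FDRep ℂ G)
    (hcomplete : ∀ X : FDRep ℂ G, Simple X → ∃ i, Nonempty (X ≅ V i))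
    (f : G → ℂ) (hf : ∀ g h, f (h * g * h⁻¹) = f g)
    (h0 : ∀ i, ∑ g, f g * (V i).character g = 0) (g : G) : f g = 0 := by
  classical
  have hinv : Invertible (Nat.card G : ℂ) :=
    invertibleOfNonzero (Nat.cast_ne_zero.2 Nat.card_pos.ne')
  have hz : NeZero (Nat.card G : ℂ) := ⟨Nat.cast_ne_zero.2 Nat.card_pos.ne'⟩
  let a : ℂ[G] := ∑ g, MonoidAlgebra.single g (f g)
  have hfd : FiniteDimensional ℂ ℂ[G] := 
    Module.Finite.equiv (MonoidAlgebra.coeffLinearEquiv ℂ).symm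
  have key : ∀ m : Submodule ℂ[G] ℂ[G], IsSimpleModule ℂ[G] m → ∀ x ∈ m, a * x = 0 := by
    intro m hm x hx
    let ρ : Representation ℂ G m := ofModule' m
    have hρ : ∀ r x, ρ.asAlgebraHom r x = r • x := fun r x => by
      simp only [ρ, ofModule', asAlgebraHom_def]
      rw [Equiv.apply_symm_apply]
      rfl
    let e : ρ.asModule ≃ₗ[ℂ[G]] m :=
      { ρ.asModuleEquiv.toAddEquiv with map_smul' := fun r x => hρ r x }
    have hirr : Representation.IsIrreducible ρ :=
      (irreducible_iff_isSimpleModule_asModule ρ).2 (IsSimpleModule.congr e)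
    have hs : Simple (FDRep.of ρ) := by
      rw [FDRep.simple_iff_char_is_norm_one]
      have := Representation.char_orthonormal ρ ρ
      rw [if_pos ⟨Representation.Equiv.refl ρ⟩] at this
      exact ((inv_mul_eq_one₀ hz.out).1 this).symm
    obtain ⟨i, ⟨e⟩⟩ := hcomplete _ hs
    have hz := sum_smul_eq_zero_of_isIrreducible ρ f hf (by
      have := h0 i
      rw [← FDRep.char_iso e] at this
      exact this)
    have ha : ρ.asAlgebraHom a = 0 := by
      simpa only [a, map_sum, asAlgebraHom_single] using hz
    have hy := hρ a ⟨x, hx⟩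
    rw [ha, LinearMap.zero_apply] at hy
    exact (congrArg Subtype.val hy).symm
  have ha : a * 1 = 0 := by
    have h1 : (1 : ℂ[G]) ∈ sSup {m : Submodule ℂ[G] ℂ[G] | IsSimpleModule ℂ[G] m} := by
      rw [IsSemisimpleModule.sSup_simples_eq_top]
      trivial
    rw [sSup_eq_iSup'] at h1
    refine Submodule.iSup_induction _ (motive := fun x => a * x = 0) h1
      (fun m x hx => key m.1 m.2 x hx) (mul_zero a) fun x y hx hy => ?_
    rw [mul_add, hx, hy, add_zero]
  have := DFunLike.congr_fun (congrArg MonoidAlgebra.coeff ((mul_one a).symm.trans ha)) g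
  simpa [a, MonoidAlgebra.coeff_sum, Finsupp.finsetSum_apply, Finsupp.single_apply] using this

/-- Fourier expansion of a class function in irreducible characters. -/
theorem classFunction_eq_sum {G : Type} [Group G] [Fintype G] {ι : Type} [Fintype ι]
    (V : ι → FDRep ℂ G) (hsimple : ∀ i, Simple (V i))
    (hdistinct : ∀ i j, Nonempty (V i ≅ V j) → i = j)
    (hcomplete : ∀ X : FDRep ℂ G, Simple X → ∃ i, Nonempty (X ≅ V i))
    (f : G → ℂ) (hf : ∀ g h, f (h * g * h⁻¹) = f g) (g : G) :
    ∑ i, ((Fintype.card G : ℂ)⁻¹ * ∑ x, f x * (V i).character x⁻¹) * (V i).character g =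
      f g := by
  classical
  have hinv : Invertible (Nat.card G : ℂ) :=
    invertibleOfNonzero (Nat.cast_ne_zero.2 Nat.card_pos.ne')
  have horth : ∀ i j, (Fintype.card G : ℂ)⁻¹ *
      ∑ x, (V i).character x⁻¹ * (V j).character x = if i = j then 1 else 0 := by
    intro i j
    have := hsimple i
    have := hsimple j
    have h := FDRep.char_orthonormal (V j) (V i)
    simp only [Nat.card_eq_fintype_card, mul_comm ((V j).character _)] at h
    rw [h]
    refine if_congr ⟨fun e => (hdistinct _ _ e).symm, ?_⟩ rfl rfl
    rintro rfl
    exact ⟨Iso.refl _⟩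
  set c : ι → ℂ := fun i => (Fintype.card G : ℂ)⁻¹ * ∑ x, f x * (V i).character x⁻¹ with hc
  have hG : (Fintype.card G : ℂ) ≠ 0 := Nat.cast_ne_zero.2 Fintype.card_ne_zero
  have hzero := classFunction_eq_zero V hcomplete
    (fun x => f x⁻¹ - ∑ i, c i * (V i).character x⁻¹)
    (fun x h => by
      have : (h * x * h⁻¹)⁻¹ = h * x⁻¹ * h⁻¹ := by group
      simp only [this, hf, FDRep.char_conj])
    (fun j => by
      have h1 : ∑ x, f x⁻¹ * (V j).character x = Fintype.card G * c j := by
        rw [hc, mul_inv_cancel_left₀ hG]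
        exact Fintype.sum_equiv (Equiv.inv G) _ _ fun x => by simp
      have h2 : ∀ i, ∑ x, (V i).character x⁻¹ * (V j).character x =
          Fintype.card G * if i = j then 1 else 0 := fun i => by
        rw [← horth, mul_inv_cancel_left₀ hG]
      simp only [sub_mul, Finset.sum_sub_distrib, h1, Finset.sum_mul]
      rw [Finset.sum_comm]
      simp only [mul_assoc, ← Finset.mul_sum, h2]
      simp [mul_comm]) g⁻¹
  simp only [inv_inv] at hzero
  exact (sub_eq_zero.1 hzero).symm

/-- The dimension of a simple representation is nonzero. -/
theorem dimC_ne_zero {G : Type} [Group G] [Fintype G] (X : FDRep ℂ G) [Simple X] :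
    (dimC X : ℂ) ≠ 0 := by
  intro h
  have h0 : Module.finrank ℂ X = 0 := Nat.cast_eq_zero.1 h
  have hsub : Subsingleton X := Module.finrank_zero_iff.1 h0
  have hχ : ∀ g, X.character g = 0 := fun g => by
    rw [FDRep.character, Subsingleton.elim (X.ρ g) 0, map_zero]
  have hX := (FDRep.simple_iff_char_is_norm_one X).1 inferInstance
  simp only [hχ, mul_zero, Finset.sum_const_zero] at hX
  exact Nat.card_pos.ne' (Nat.cast_eq_zero.1 hX.symm)

end

open scoped Classical in
/-- Proposition 2 of the paper: the functions `ψ_C` are eigenfunctions of `L_η`, with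
eigenvalue `χ^η(C)/dim η`, and they form an orthonormal basis of `L²(π)`. -/
theorem L_eigenfunctions {G : Type} [Group G] [Fintype G]
    {ι : Type} [Fintype ι] (V : ι → FDRep ℂ G)
    (hsimple : ∀ i, Simple (V i))
    (hdistinct : ∀ i j, Nonempty (V i ≅ V j) → i = j)
    (hcomplete : ∀ X : FDRep ℂ G, Simple X → ∃ i, Nonempty (X ≅ V i))
    (η : FDRep ℂ G) (hreal : ∀ g : G, (η.character g).im = 0) :
    (∀ (g : G) (i : ι),
      ∑ j, L η (V i) (V j) * psiC g (V j) = η.character g / (dimC η : ℂ) * psiC g (V i)) ∧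
    (∀ g g' : G,
      ∑ j, plancherel (V j) * psiC g (V j) * (starRingEnd ℂ) (psiC g' (V j)) =
        if IsConj g g' then 1 else 0) := by
  refine ⟨fun g i => ?_, fun g g' => ?_⟩
  · have := hsimple i
    have hexp := classFunction_eq_sum V hsimple hdistinct hcomplete
      (fun x => η.character x * (V i).character x) (fun x h => by simp only [FDRep.char_conj]) g
    have hinner : ∀ j, innerCF G (V j).character (fun x => η.character x * (V i).character x) =
        (Fintype.card G : ℂ)⁻¹ *
          ∑ x, η.character x * (V i).character x * (V j).character x⁻¹ := fun j => by
      rw [innerCF]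
      congr 1
      refine Fintype.sum_equiv (Equiv.inv G) _ _ fun x => ?_
      simp only [Equiv.inv_apply, inv_inv, map_mul, ← character_inv]
      ring
    simp only [← hinner] at hexp
    have hterm : ∀ j, L η (V i) (V j) * psiC g (V j) =
        (Real.sqrt (Nat.card {h : G // IsConj g h}) : ℂ) / ((dimC η : ℂ) * (dimC (V i) : ℂ)) *
          (innerCF G (V j).character (fun x => η.character x * (V i).character x) *
            (V j).character g) := fun j => by
      have := hsimple j
      have hj := dimC_ne_zero (V j)
      rw [L, psiC]
      field_simp
    simp only [hterm, ← Finset.mul_sum, hexp]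
    rw [psiC]
    ring
  · have hexp := classFunction_eq_sum V hsimple hdistinct hcomplete
      (fun x => if IsConj g' x then 1 else 0) (fun x h => by
        have hx : IsConj x (h * x * h⁻¹) := isConj_iff.2 ⟨h, rfl⟩
        exact if_congr ⟨fun hc => hc.trans hx.symm, fun hc => hc.trans hx⟩ rfl rfl) g
    have hsum : ∀ j, ∑ x, (if IsConj g' x then (1 : ℂ) else 0) * (V j).character x⁻¹ =
        (Nat.card {h : G // IsConj g' h} : ℂ) * (starRingEnd ℂ) ((V j).character g') := by
      intro j
      have : ∀ x, (if IsConj g' x then (1 : ℂ) else 0) * (V j).character x⁻¹ =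
          if IsConj g' x then (starRingEnd ℂ) ((V j).character g') else 0 := fun x => by
        split_ifs with hx
        · obtain ⟨c, rfl⟩ := isConj_iff.1 hx
          rw [character_inv, FDRep.char_conj, one_mul]
        · rw [zero_mul]
      simp only [this]
      rw [← Finset.sum_filter, Finset.sum_const, nsmul_eq_mul, Nat.card_eq_fintype_card,
        Fintype.card_subtype]
    simp only [hsum] at hexp
    set r : ℂ := (Real.sqrt (Nat.card {h : G // IsConj g h}) : ℂ) with hr
    set r' : ℂ := (Real.sqrt (Nat.card {h : G // IsConj g' h}) : ℂ) with hr'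
    have hsq : r' * r' = (Nat.card {h : G // IsConj g' h} : ℂ) := by
      rw [hr', ← Complex.ofReal_mul, Real.mul_self_sqrt (Nat.cast_nonneg _),
        Complex.ofReal_natCast]
    have : Nonempty {h : G // IsConj g' h} := ⟨⟨g', IsConj.refl g'⟩⟩
    have hr0 : r' ≠ 0 := fun h => by
      rw [h, zero_mul, eq_comm, Nat.cast_eq_zero] at hsq
      exact Nat.card_pos.ne' hsq
    have hterm : ∀ j, plancherel (V j) * psiC g (V j) * (starRingEnd ℂ) (psiC g' (V j)) =
        r / r' * ((Fintype.card G : ℂ)⁻¹ * ((Nat.card {h : G // IsConj g' h} : ℂ) *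
          (starRingEnd ℂ) ((V j).character g')) * (V j).character g) := fun j => by
      have := hsimple j
      have hj := dimC_ne_zero (V j)
      rw [plancherel, psiC, psiC, ← hsq, ← hr, ← hr', map_div₀, map_mul, hr', Complex.conj_ofReal,
        ← hr', Complex.conj_natCast]
      field_simp
    simp only [hterm, ← Finset.mul_sum, hexp]
    by_cases hc : IsConj g g'
    · have hcard : r = r' := by
        rw [hr, hr', Nat.card_congr (Equiv.subtypeEquivRight fun h =>
          (⟨fun k => hc.symm.trans k, fun k => hc.trans k⟩ : IsConj g h ↔ IsConj g' h))]
      rw [if_pos hc, if_pos hc.symm, hcard, mul_one, div_self hr0]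
    · rw [if_neg hc, if_neg fun k => hc k.symm, mul_zero]

end SteinRep
end

section
/- Suppose α ≥ 1, n ≥ 2, and r ≥ 1 is an integer. Then the probability that the Metropolis chain T_α on the symmetric group S_n, started at the identity, returns to the identity after r steps equals the r-th moment of (α·n(λ')−n(λ))/(α·C(n,2)) under Jack_α measure; that is, (T_α^r)(id,id) = Σ_{λ partition of n} π_α(λ)·((α·n(λ')−n(λ))/(α·C(n,2)))^r, where T_α^r denotes the r-th matrix power of the transition matrix T_α. -/
open Finset

namespace JackTest

def colLen {n : ℕ} (lam : n.Partition) (j : ℕ) : ℕ :=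
  (lam.parts.filter (fun p => j < p)).card

def rowLen {n : ℕ} (lam : n.Partition) (i : ℕ) : ℕ :=
  ((Finset.range n).filter (fun j => i < colLen lam j)).card

def cells {n : ℕ} (lam : n.Partition) : Finset (ℕ × ℕ) :=
  (Finset.range n ×ˢ Finset.range n).filter (fun s => s.2 < rowLen lam s.1)

def arm {n : ℕ} (lam : n.Partition) (s : ℕ × ℕ) : ℕ := rowLen lam s.1 - (s.2 + 1)

def leg {n : ℕ} (lam : n.Partition) (s : ℕ × ℕ) : ℕ := colLen lam s.2 - (s.1 + 1)

noncomputable def cLow (α : ℝ) {n : ℕ} (lam : n.Partition) : ℝ :=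
  ∏ s ∈ cells lam, (α * arm lam s + leg lam s + 1)

noncomputable def cUp (α : ℝ) {n : ℕ} (lam : n.Partition) : ℝ :=
  ∏ s ∈ cells lam, (α * arm lam s + leg lam s + α)

noncomputable def jackP (α : ℝ) {n : ℕ} (lam : n.Partition) : ℝ :=
  α ^ n * (n.factorial) / (cLow α lam * cUp α lam)

def nStat {n : ℕ} (lam : n.Partition) : ℕ := ∑ i ∈ Finset.range n, i * rowLen lam i

def nStatConj {n : ℕ} (lam : n.Partition) : ℕ := ∑ j ∈ Finset.range n, j * colLen lam j

noncomputable def W (α : ℝ) {n : ℕ} (lam : n.Partition) : ℝ :=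
  (α * nStatConj lam - nStat lam) / Real.sqrt (α * n.choose 2)

noncomputable def Phi (x : ℝ) : ℝ :=
  (Real.sqrt (2 * Real.pi))⁻¹ * ∫ t in Set.Iic x, Real.exp (-t ^ 2 / 2)


/-- Number of cycles (including fixed points) of a permutation. -/
def numCycles {n : ℕ} (x : Equiv.Perm (Fin n)) : ℕ := x.partition.parts.card

open scoped Classical in
/-- Hanlon's Metropolis chain `T_α` on the symmetric group `S_n`, as a matrix. -/
noncomputable def Tmat (α : ℝ) (n : ℕ) :
    Matrix (Equiv.Perm (Fin n)) (Equiv.Perm (Fin n)) ℝ := fun x y =>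
  if y = x then (α - 1) * nStatConj x.partition / (α * n.choose 2)
  else if (x⁻¹ * y).IsSwap ∧ numCycles y + 1 = numCycles x then 1 / (n.choose 2 : ℝ)
  else if (x⁻¹ * y).IsSwap ∧ numCycles y = numCycles x + 1 then 1 / (α * n.choose 2)
  else 0

section Abstract

variable {B P Q : Type*} [Ring B] [Algebra ℝ B]

/-- Pairs (operator word, eigenvalue function) generated by a Hamiltonian and its integrals. -/
def wordPairs (D : B) (I : ℕ → B) (e : P → ℝ) (M : ℕ → P → ℝ) : Subalgebra ℝ (B × (P → ℝ)) :=
  Algebra.adjoin ℝ ({(D, e)} ∪ Set.range fun k => (I k, M k))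

/-- The span of the pairs `(e_j w, c^j φ)`, where `(w, φ)` is a word pair. -/
def creationSpan (D : B) (I : ℕ → B) (e : P → ℝ) (M : ℕ → P → ℝ) (E : ℕ → B)
    (src : Q → P) (c : Q → ℝ) : Submodule ℝ (B × (Q → ℝ)) :=
  Submodule.span ℝ {s | ∃ j, ∃ w ∈ wordPairs D I e M,
    s = (E j * w.1, fun q => c q ^ j * w.2 (src q))}

variable {D X : B} {I E : ℕ → B} {e : P → ℝ} {M : ℕ → P → ℝ}
  {src tgt : Q → P} {c : Q → ℝ} {α β : ℝ}

theorem creationSpan_mul_right {s : B × (Q → ℝ)} (hs : s ∈ creationSpan D I e M E src c)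
    {w : B × (P → ℝ)} (hw : w ∈ wordPairs D I e M) :
    (s.1 * w.1, fun q => s.2 q * w.2 (src q)) ∈ creationSpan D I e M E src c := by
  induction hs using Submodule.span_induction with
  | mem x hx =>
    obtain ⟨j, v, hv, rfl⟩ := hx
    refine Submodule.subset_span ⟨j, v * w, mul_mem hv hw, ?_⟩
    ext <;> simp [mul_assoc]
  | zero =>
    convert Submodule.zero_mem _ using 1
    ext <;> simp
  | add x y _ _ hx hy =>
    convert Submodule.add_mem _ hx hy using 1
    ext <;> simp [add_mul]
  | smul a x _ hx =>
    convert Submodule.smul_mem _ a hx using 1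
    ext <;> simp [mul_assoc]

theorem hamiltonian_mem : (D, e) ∈ wordPairs D I e M :=
  Algebra.subset_adjoin (Or.inl rfl)

theorem integral_mem (k : ℕ) : (I k, M k) ∈ wordPairs D I e M :=
  Algebra.subset_adjoin (Or.inr ⟨k, rfl⟩)

theorem creationSpan_ad (hE : ∀ k, E (k + 1) = D * E k - E k * D)
    {s : B × (Q → ℝ)} (hs : s ∈ creationSpan D I e M E src c) :
    (D * s.1 - s.1 * D, fun q => c q * s.2 q) ∈ creationSpan D I e M E src c := by
  induction hs using Submodule.span_induction with
  | mem x hx =>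
    obtain ⟨j, v, hv, rfl⟩ := hx
    have h1 : (E (j + 1) * v.1, fun q => c q ^ (j + 1) * v.2 (src q)) ∈
        creationSpan D I e M E src c := Submodule.subset_span ⟨j + 1, v, hv, rfl⟩
    have h2 : (E j * (D * v.1), fun q => c q ^ j * (e (src q) * v.2 (src q))) ∈
        creationSpan D I e M E src c :=
      Submodule.subset_span ⟨j, _, mul_mem hamiltonian_mem hv, rfl⟩
    have h3 : (E j * (v.1 * D), fun q => c q ^ j * (v.2 (src q) * e (src q))) ∈
        creationSpan D I e M E src c :=
      Submodule.subset_span ⟨j, _, mul_mem hv hamiltonian_mem, rfl⟩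
    convert Submodule.sub_mem _ (Submodule.add_mem _ h1 h2) h3 using 1
    ext
    · simp only [hE, Prod.fst_sub, Prod.fst_add]; noncomm_ring
    · simp only [Prod.snd_sub, Prod.snd_add, Pi.add_apply, Pi.sub_apply]; ring
  | zero =>
    convert Submodule.zero_mem _ using 1
    ext <;> simp
  | add x y _ _ hx hy =>
    convert Submodule.add_mem _ hx hy using 1
    ext
    · simp only [Prod.fst_add]; noncomm_ring
    · simp [mul_add]
  | smul a x _ hx =>
    convert Submodule.smul_mem _ a hx using 1
    ext
    · simp [smul_sub]
    · simp only [Prod.smul_snd, Pi.smul_apply, smul_eq_mul]; ring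

theorem creation_mem (hE0 : E 0 = X) : (X, fun _ => 1) ∈ creationSpan D I e M E src c :=
  Submodule.subset_span ⟨0, 1, one_mem _, by ext <;> simp [hE0]⟩

theorem integral_comm_creation_mem (hE0 : E 0 = X) (hE : ∀ k, E (k + 1) = D * E k - E k * D)
    (hM0 : ∀ q, M 0 (tgt q) = M 0 (src q)) (hM1 : ∀ q, M 1 (tgt q) = M 1 (src q))
    (hI0 : I 0 * X = X * I 0) (hI1 : I 1 * X = X * I 1)
    (hI : ∀ k, ∀ C : ℕ → B, (∀ k, C k = I k * X - X * I k) →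
      C (k + 2) = (2 : ℝ) • (D * C (k + 1) - C (k + 1) * D) + β • C (k + 1)
        - (D * (D * C k - C k * D) - (D * C k - C k * D) * D) - β • (D * C k - C k * D)
        + α • (I k * X))
    (hM : ∀ k q, ∀ C : ℕ → ℝ, (∀ k, C k = M k (tgt q) - M k (src q)) →
      C (k + 2) = (2 * c q + β) * C (k + 1) - (c q ^ 2 + β * c q) * C k + α * M k (tgt q))
    (k : ℕ) :
    (I k * X - X * I k, fun q => M k (tgt q) - M k (src q)) ∈ creationSpan D I e M E src c := by
  set S := creationSpan D I e M E src c
  suffices h : ∀ k, (I k * X - X * I k, fun q => M k (tgt q) - M k (src q)) ∈ S ∧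
      (I (k + 1) * X - X * I (k + 1), fun q => M (k + 1) (tgt q) - M (k + 1) (src q)) ∈ S from
    (h k).1
  intro k
  induction k with
  | zero =>
    constructor
    · convert S.zero_mem using 1
      ext <;> simp [hM0, hI0]
    · convert S.zero_mem using 1
      ext <;> simp [hM1, hI1]
  | succ k ih =>
    refine ⟨ih.2, ?_⟩
    have h1 := creationSpan_ad hE ih.2
    have h0 := creationSpan_ad hE ih.1
    have h00 := creationSpan_ad hE h0
    have h2 := S.add_mem ih.1 (creationSpan_mul_right (creation_mem hE0) (integral_mem k))
    convert S.add_mem (S.sub_mem (S.sub_mem (S.add_mem (S.smul_mem 2 h1) (S.smul_mem β ih.2)) h00)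
      (S.smul_mem β h0)) (S.smul_mem α h2) using 1
    ext q
    · have := hI k (fun k => I k * X - X * I k) (fun _ => rfl)
      simp only [Prod.fst_add, Prod.fst_sub, Prod.smul_fst]
      rw [show k + 1 + 1 = k + 2 from rfl, this]
      simp
    · have := hM k q (fun k => M k (tgt q) - M k (src q)) (fun _ => rfl)
      simp only [Prod.snd_add, Prod.snd_sub, Prod.smul_snd, Pi.add_apply, Pi.sub_apply,
        Pi.smul_apply, smul_eq_mul]
      rw [show k + 1 + 1 = k + 2 from rfl, this]
      ring

theorem word_mul_creation_mem (hE0 : E 0 = X) (hE : ∀ k, E (k + 1) = D * E k - E k * D)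
    (hDI : ∀ k, D * I k = I k * D)
    (he : ∀ q, e (tgt q) = e (src q) + c q)
    (hC : ∀ k, (I k * X - X * I k, fun q => M k (tgt q) - M k (src q)) ∈
      creationSpan D I e M E src c)
    {w : B × (P → ℝ)} (hw : w ∈ wordPairs D I e M) :
    (w.1 * X, fun q => w.2 (tgt q)) ∈ creationSpan D I e M E src c := by
  set S := creationSpan D I e M E src c
  suffices h : ∀ s ∈ S, (w.1 * s.1, fun q => w.2 (tgt q) * s.2 q) ∈ S by
    simpa using h _ (creation_mem hE0)
  refine Algebra.adjoin_induction (p := fun w _ => ∀ s ∈ S,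
    (w.1 * s.1, fun q => w.2 (tgt q) * s.2 q) ∈ S) ?_ ?_ ?_ ?_ hw
  · rintro x (rfl | ⟨k, rfl⟩) s hs
    · convert S.add_mem (creationSpan_ad hE hs) (creationSpan_mul_right hs hamiltonian_mem) using 1
      ext
      · simp
      · simp only [he, Prod.snd_add, Pi.add_apply]; ring
    · have hIE : ∀ j, (I k * E j, fun q => M k (tgt q) * c q ^ j) ∈ S := by
        intro j
        induction j with
        | zero =>
          convert S.add_mem (hC k)
            (creationSpan_mul_right (creation_mem hE0) (integral_mem k)) using 1
          ext <;> simp [hE0]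
        | succ j ih =>
          convert creationSpan_ad hE ih using 1
          ext
          · simp only [hE]
            rw [← mul_assoc D, hDI]
            noncomm_ring
          · simp only; ring
      induction hs using Submodule.span_induction with
      | mem x hx =>
        obtain ⟨j, v, hv, rfl⟩ := hx
        convert creationSpan_mul_right (hIE j) hv using 1
        ext <;> simp [mul_assoc]
      | zero =>
        convert Submodule.zero_mem _ using 1
        ext <;> simp
      | add x y _ _ hx hy =>
        convert Submodule.add_mem _ hx hy using 1
        ext <;> simp [mul_add]
      | smul a x _ hx =>
        convert Submodule.smul_mem _ a hx using 1
        ext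
        · simp
        · simp only [Prod.smul_snd, Pi.smul_apply, smul_eq_mul]; ring
  · intro r s hs
    convert S.smul_mem r hs using 1
    ext
    · simp [Algebra.algebraMap_eq_smul_one]
    · simp
  · intro x y _ _ hx hy s hs
    convert S.add_mem (hx s hs) (hy s hs) using 1
    ext <;> simp [add_mul]
  · intro x y _ _ hx hy s hs
    convert hx _ (hy s hs) using 1
    ext <;> simp [mul_assoc]

theorem functional_word_mul_pow
    (hEX : ∀ {w : B × (P → ℝ)}, w ∈ wordPairs D I e M →
      (w.1 * X, fun q => w.2 (tgt q)) ∈ creationSpan D I e M E src c)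
    (l : B →ₗ[ℝ] ℝ) (hl : ∀ j w, l (E j * w) = l (I j * w))
    (μ : ℕ → (P → ℝ) →ₗ[ℝ] ℝ) (ν : ℕ → (Q → ℝ) →ₗ[ℝ] ℝ)
    (hμν : ∀ n (φ : P → ℝ), μ (n + 1) φ = ν n (fun q => φ (tgt q)))
    (hνμ : ∀ n j (φ : P → ℝ), ν n (fun q => c q ^ j * φ (src q)) = μ n (fun p => M j p * φ p))
    (h0 : ∀ w ∈ wordPairs D I e M, l w.1 = μ 0 w.2) (n : ℕ) :
    ∀ w ∈ wordPairs D I e M, l (w.1 * X ^ n) = μ n w.2 := by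
  induction n with
  | zero => simpa using h0
  | succ n ih =>
    intro w hw
    rw [hμν, pow_succ', ← mul_assoc]
    suffices h : ∀ s ∈ creationSpan D I e M E src c, l (s.1 * X ^ n) = ν n s.2 from
      h _ (hEX hw)
    intro s hs
    induction hs using Submodule.span_induction with
    | mem x hx =>
      obtain ⟨j, v, hv, rfl⟩ := hx
      rw [mul_assoc, hl, hνμ, ← mul_assoc]
      exact ih _ (mul_mem (integral_mem j) hv)
    | zero => simp
    | add x y _ _ hx hy => simp [add_mul, hx, hy]
    | smul a x _ hx => simp [hx]

end Abstract

section Fock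

open Polynomial

/-- Polynomials in the power sums; the variable `X i` stands for the power sum `p_{i+1}`. -/
abbrev Fock := MvPolynomial ℕ ℝ

/-- Marks a point: sends the cycle variable `X i` to `(i + 1) w ^ i`. -/
noncomputable def mark : Derivation ℝ Fock Fock[X] :=
  MvPolynomial.mkDerivation ℝ fun i => ((i : Fock[X]) + 1) * X ^ i

/-- Constant polynomials, as a linear map. -/
noncomputable def markedFix : Fock →ₗ[ℝ] Fock[X] := (CAlgHom (R := ℝ) (A := Fock)).toLinearMap

/-- Forgets the mark: sends `w ^ i` to the cycle variable `X i`. -/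
noncomputable def forget : Fock[X] →ₗ[ℝ] Fock :=
  lsum fun i => LinearMap.mulRight ℝ (MvPolynomial.X i)

/-- The terms that split a marked cycle at the mark. -/
noncomputable def splitPoly (β : ℝ) (i : ℕ) : Fock[X] :=
  ∑ j ∈ range i, X ^ j * C (MvPolynomial.X (i - (j + 1))) + (β * i) • X ^ i

/-- The terms that split the cycle containing the mark. -/
noncomputable def splitAll (β : ℝ) (i : ℕ) : Fock[X] :=
  ∑ j ∈ range i, ((j : Fock[X]) + 1) * (X ^ j * C (MvPolynomial.X (i - (j + 1))))
    + (β * i * (i + 1) / 2) • X ^ i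

/-- The Lax operator of the deformed cut-and-join Hamiltonian. -/
noncomputable def lax (α β : ℝ) : Module.End ℝ Fock[X] :=
  lsum fun i => LinearMap.mulLeft ℝ (α • X ^ (i + 1)) ∘ₗ mark.toLinearMap
    + LinearMap.mulRight ℝ (splitPoly β i) ∘ₗ markedFix

/-- The deformed cut-and-join Hamiltonian. -/
noncomputable def ham (α β : ℝ) : Module.End ℝ Fock :=
  (1 / 2 : ℝ) • forget ∘ₗ lax α β ∘ₗ mark.toLinearMap

/-- The cut-and-join Hamiltonian acting on marked states. -/
noncomputable def markedHam (α β : ℝ) : Module.End ℝ Fock[X] :=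
  lsum fun i => LinearMap.mulRight ℝ (X ^ i) ∘ₗ markedFix ∘ₗ ham α β
    + LinearMap.mulLeft ℝ ((α * (i + 1)) • X ^ (i + 1)) ∘ₗ mark.toLinearMap
    + LinearMap.mulRight ℝ (splitAll β i) ∘ₗ markedFix

@[simp] theorem markedFix_apply (f : Fock) : markedFix f = C f := rfl

@[simp] theorem mark_X (i : ℕ) : mark (MvPolynomial.X i) = ((i : Fock[X]) + 1) * X ^ i := by
  simp [mark, MvPolynomial.mkDerivation_X]

theorem mark_mul (f g : Fock) : mark (f * g) = C f * mark g + C g * mark f := by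
  rw [Derivation.leibniz, smul_eq_C_mul, smul_eq_C_mul]

theorem lsum_C_mul_X_pow {M : Type*} [AddCommMonoid M] [Module ℝ M] (F : ℕ → Fock →ₗ[ℝ] M)
    (f : Fock) (i : ℕ) : lsum F (C f * X ^ i) = F i f := by
  simp [lsum, C_mul_X_pow_eq_monomial, sum_monomial_index]

theorem marked_ext {M : Type*} [AddCommGroup M] [Module ℝ M] {F G : Fock[X] →ₗ[ℝ] M}
    (h : ∀ f i, F (C f * X ^ i) = G (C f * X ^ i)) : F = G := by
  ext1 p
  induction p using Polynomial.induction_on' with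
  | add p q hp hq => simp [hp, hq]
  | monomial i f => rw [← C_mul_X_pow_eq_monomial, h]

theorem forget_mul (f : Fock) (g : Fock[X]) : forget (C f * g) = f * forget g := by
  suffices h : forget ∘ₗ LinearMap.mulLeft ℝ (C f) = LinearMap.mulLeft ℝ f ∘ₗ forget from
    LinearMap.congr_fun h g
  refine marked_ext fun g i => ?_
  simp only [LinearMap.comp_apply, LinearMap.mulLeft_apply]
  rw [← mul_assoc, ← C_mul, forget, lsum_C_mul_X_pow, lsum_C_mul_X_pow]
  simp [mul_assoc]

@[simp] theorem forget_X_pow (i : ℕ) : forget (X ^ i) = MvPolynomial.X i := by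
  simpa [forget] using lsum_C_mul_X_pow (fun i => LinearMap.mulRight ℝ (MvPolynomial.X i)) 1 i

theorem lax_apply (α β : ℝ) (f : Fock) (i : ℕ) :
    lax α β (C f * X ^ i) = α • (X ^ (i + 1) * mark f) + C f * splitPoly β i := by
  rw [lax, lsum_C_mul_X_pow]
  simp

theorem markedHam_apply (α β : ℝ) (f : Fock) (i : ℕ) :
    markedHam α β (C f * X ^ i) = C (ham α β f) * X ^ i
      + (α * (i + 1)) • (X ^ (i + 1) * mark f) + C f * splitAll β i := by
  rw [markedHam, lsum_C_mul_X_pow]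
  simp

theorem splitPoly_succ (β : ℝ) (i : ℕ) :
    splitPoly β (i + 1) = X * splitPoly β i + C (MvPolynomial.X i) + β • X ^ (i + 1) := by
  rw [splitPoly, sum_range_succ', splitPoly, mul_add, mul_sum]
  simp only [Algebra.smul_def, Nat.add_sub_add_right, map_mul, map_natCast, pow_zero, zero_add,
    Nat.add_sub_cancel, one_mul]
  push_cast
  simp only [pow_succ']
  simp only [mul_assoc]
  ring

theorem splitAll_succ (β : ℝ) (i : ℕ) :
    splitAll β (i + 1) = X * splitAll β i + splitPoly β (i + 1) := by
  rw [splitPoly_succ, splitAll, sum_range_succ', splitAll, splitPoly]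
  simp only [mul_add (X : Fock[X]), mul_sum]
  have h : ∀ j ∈ range i, ((↑(j + 1) : Fock[X]) + 1) * (X ^ (j + 1) *
        C (MvPolynomial.X (i + 1 - (j + 1 + 1)))) =
      X * (((j : Fock[X]) + 1) * (X ^ j * C (MvPolynomial.X (i - (j + 1))))) +
      X * (X ^ j * C (MvPolynomial.X (i - (j + 1)))) := by
    intro j _
    rw [Nat.add_sub_add_right]
    push_cast
    ring
  rw [sum_congr rfl h, sum_add_distrib]
  have h2 : (β * ↑(i + 1) * (↑(i + 1) + 1) / 2) • (X : Fock[X]) ^ (i + 1) =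
     X * ((β * i * (i + 1) / 2) • X ^ i) + (X * (β * i) • X ^ i + β • X ^ (i + 1)) := by
    rw [mul_smul_comm, mul_smul_comm, ← pow_succ', ← add_smul, ← add_smul]
    congr 1
    push_cast
    ring
  rw [h2]
  simp
  ring

theorem splitPoly_zero (β : ℝ) : splitPoly β 0 = 0 := by simp [splitPoly]

theorem splitAll_zero (β : ℝ) : splitAll β 0 = 0 := by simp [splitAll]

theorem lax_mul_var (α β : ℝ) (j : ℕ) (g : Fock[X]) :
    lax α β (C (MvPolynomial.X j) * g) =
      C (MvPolynomial.X j) * lax α β g + (α * (j + 1)) • (X ^ (j + 1) * g) := by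
  suffices h : lax α β ∘ₗ LinearMap.mulLeft ℝ (C (MvPolynomial.X j)) =
      LinearMap.mulLeft ℝ (C (MvPolynomial.X j)) ∘ₗ lax α β +
      (α * (j + 1)) • LinearMap.mulLeft ℝ (X ^ (j + 1)) from LinearMap.congr_fun h g
  refine marked_ext fun g i => ?_
  simp only [LinearMap.comp_apply, LinearMap.mulLeft_apply, LinearMap.add_apply,
    LinearMap.smul_apply]
  rw [← mul_assoc, ← C_mul, lax_apply, lax_apply, mark_mul, mark_X]
  simp only [Algebra.smul_def, map_mul, map_add, map_one, map_natCast]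
  ring

theorem lax_mul_X (α β : ℝ) (g : Fock[X]) :
    lax α β (X * g) = X * lax α β g + C (forget g) + β • (X * g) := by
  suffices h : lax α β ∘ₗ LinearMap.mulLeft ℝ X =
      LinearMap.mulLeft ℝ X ∘ₗ lax α β + markedFix ∘ₗ forget + β • LinearMap.mulLeft ℝ X from
    LinearMap.congr_fun h g
  refine marked_ext fun g i => ?_
  simp only [LinearMap.comp_apply, LinearMap.mulLeft_apply, LinearMap.add_apply,
    LinearMap.smul_apply, forget_mul, forget_X_pow, markedFix_apply]
  rw [show X * (C g * X ^ i) = C g * X ^ (i + 1) by ring, lax_apply, lax_apply, splitPoly_succ]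
  simp only [Algebra.smul_def, C_mul]
  ring

theorem lax_C (α β : ℝ) (f : Fock) : lax α β (C f) = α • (X * mark f) := by
  simpa [splitPoly_zero] using lax_apply α β f 0

theorem ham_one (α β : ℝ) : ham α β 1 = 0 := by simp [ham]

theorem ham_mul_var (α β : ℝ) (j : ℕ) (f : Fock) :
    ham α β (MvPolynomial.X j * f) = MvPolynomial.X j * ham α β f
      + ((j + 1) / 2 : ℝ) • (f * forget (splitPoly β j))
      + (α * (j + 1)) • forget (X ^ (j + 1) * mark f) := by
  have h : ((j : Fock[X]) + 1) = algebraMap ℝ _ ((j : ℝ) + 1) := by simp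
  have hm : ∀ g : Fock, ham α β g = (1 / 2 : ℝ) • forget (lax α β (mark g)) := fun _ => rfl
  simp only [hm]
  rw [mark_mul, mark_X, map_add, lax_mul_var, h, ← Algebra.smul_def, mul_smul_comm,
    map_smul, lax_apply]
  simp only [map_add, map_smul, forget_mul, mul_smul_comm]
  module

theorem ham_var (α β : ℝ) (j : ℕ) :
    ham α β (MvPolynomial.X j) = ((j + 1) / 2 : ℝ) • forget (splitPoly β j) := by
  simpa [ham_one] using ham_mul_var α β j 1

theorem forget_splitPoly (β : ℝ) (i : ℕ) : forget (splitPoly β i) =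
    ∑ j ∈ range i, MvPolynomial.X (i - (j + 1)) * MvPolynomial.X j
      + (β * i) • MvPolynomial.X i := by
  simp only [splitPoly, map_add, map_sum, map_smul, mul_comm (X ^ _ : Fock[X]), forget_mul,
    forget_X_pow]

theorem sum_range_antidiagonal_mul {R : Type*} [CommRing R] (i : ℕ) (a : ℕ → R) (s : ℕ → R) :
    ∑ j ∈ range i, s j * (a (i - (j + 1)) * a j) =
      ∑ j ∈ range i, s (i - 1 - j) * (a (i - (j + 1)) * a j) := by
  rw [← sum_range_reflect]
  refine sum_congr rfl fun j hj => ?_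
  rw [mem_range] at hj
  rw [show i - (i - 1 - j + 1) = j by omega, show i - 1 - j = i - (j + 1) by omega,
    mul_comm (a j)]

theorem forget_splitAll (β : ℝ) (i : ℕ) :
    forget (splitAll β i) = ((i + 1) / 2 : ℝ) • forget (splitPoly β i) := by
  have h2 : (2 : ℝ) • ∑ j ∈ range i, ((j : Fock) + 1) *
      (MvPolynomial.X (i - (j + 1)) * MvPolynomial.X j) =
      ((i : ℝ) + 1) • ∑ j ∈ range i, MvPolynomial.X (i - (j + 1)) * MvPolynomial.X j := by
    rw [two_smul]
    nth_rw 2 [sum_range_antidiagonal_mul i MvPolynomial.X (fun j => (j : Fock) + 1)]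
    rw [← sum_add_distrib, smul_sum]
    refine sum_congr rfl fun j hj => ?_
    rw [mem_range] at hj
    rw [← add_mul, Algebra.smul_def, Nat.sub_sub, Nat.cast_sub (by omega)]
    simp
    ring
  have h3 : forget (splitAll β i) = ∑ j ∈ range i, ((j : Fock) + 1) *
      (MvPolynomial.X (i - (j + 1)) * MvPolynomial.X j)
      + (β * i * (i + 1) / 2) • MvPolynomial.X i := by
    rw [splitAll, map_add, map_sum, map_smul, forget_X_pow]
    congr 1
    refine sum_congr rfl fun j _ => ?_
    rw [show ((j : Fock[X]) + 1) * (X ^ j * C (MvPolynomial.X (i - (j + 1)))) =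
      C ((j : Fock) + 1) * (C (MvPolynomial.X (i - (j + 1))) * X ^ j) by
        simp [mul_comm (X ^ j)],
      forget_mul, forget_mul, forget_X_pow]
  rw [h3, forget_splitPoly, smul_add]
  linear_combination (norm := module) (1 / 2 : ℝ) • h2

theorem forget_markedHam (α β : ℝ) : forget ∘ₗ markedHam α β = ham α β ∘ₗ forget := by
  refine marked_ext fun f i => ?_
  simp only [LinearMap.comp_apply]
  rw [markedHam_apply, forget_mul, forget_X_pow, mul_comm f, ham_mul_var]
  simp only [map_add, map_smul, forget_mul, forget_X_pow, forget_splitAll, mul_smul_comm]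
  rw [mul_comm (ham α β f)]
  module

theorem markedHam_C (α β : ℝ) (f : Fock) :
    markedHam α β (C f) = C (ham α β f) + lax α β (C f) := by
  simpa [splitAll_zero, lax_C] using markedHam_apply α β f 0

theorem markedHam_mul_X (α β : ℝ) (g : Fock[X]) :
    markedHam α β (X * g) = X * markedHam α β g + lax α β (X * g) := by
  suffices h : markedHam α β ∘ₗ LinearMap.mulLeft ℝ X =
      LinearMap.mulLeft ℝ X ∘ₗ markedHam α β + lax α β ∘ₗ LinearMap.mulLeft ℝ X from
    LinearMap.congr_fun h g
  refine marked_ext fun g i => ?_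
  simp only [LinearMap.comp_apply, LinearMap.mulLeft_apply, LinearMap.add_apply]
  rw [show X * (C g * X ^ i) = C g * X ^ (i + 1) by ring, lax_apply, markedHam_apply,
    markedHam_apply, splitAll_succ]
  simp only [Algebra.smul_def, map_mul, map_add, map_one, map_natCast]
  push_cast
  ring

/-- The derivation `p_{k+1} ↦ (k + 1) p_{j+k+2}`. -/
noncomputable def shiftDer (j : ℕ) : Fock →ₗ[ℝ] Fock :=
  forget ∘ₗ LinearMap.mulLeft ℝ (X ^ (j + 1)) ∘ₗ mark.toLinearMap

theorem shiftDer_apply (j : ℕ) (f : Fock) : shiftDer j f = forget (X ^ (j + 1) * mark f) := rfl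

theorem shiftDer_mul_var (j k : ℕ) (f : Fock) :
    shiftDer j (MvPolynomial.X k * f) = MvPolynomial.X k * shiftDer j f
      + ((k : ℝ) + 1) • (f * MvPolynomial.X (j + k + 1)) := by
  rw [shiftDer_apply, mark_mul, mark_X, mul_add, map_add, mul_left_comm, forget_mul,
    show X ^ (j + 1) * (C f * (((k : Fock[X]) + 1) * X ^ k)) =
      C (((k : Fock) + 1) * f) * X ^ (j + k + 1) by simp; ring, forget_mul, forget_X_pow,
    shiftDer_apply]
  simp [Algebra.smul_def, mul_assoc]

/-- The first order part of the commutator of `markedHam` with a variable. -/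
noncomputable def markedShift (j : ℕ) : Fock[X] →ₗ[ℝ] Fock[X] :=
  lsum fun i => LinearMap.mulRight ℝ (X ^ i) ∘ₗ markedFix ∘ₗ shiftDer j
    + LinearMap.mulRight ℝ (((i : ℝ) + 1) • X ^ (i + j + 1)) ∘ₗ markedFix

theorem markedShift_apply (j : ℕ) (f : Fock) (i : ℕ) :
    markedShift j (C f * X ^ i) =
      C (shiftDer j f) * X ^ i + ((i : ℝ) + 1) • (C f * X ^ (i + j + 1)) := by
  rw [markedShift, lsum_C_mul_X_pow]
  simp

theorem markedHam_mul_var (α β : ℝ) (j : ℕ) (g : Fock[X]) :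
    markedHam α β (C (MvPolynomial.X j) * g) = C (MvPolynomial.X j) * markedHam α β g
      + C (ham α β (MvPolynomial.X j)) * g + (α * (j + 1)) • markedShift j g := by
  suffices h : markedHam α β ∘ₗ LinearMap.mulLeft ℝ (C (MvPolynomial.X j)) =
      LinearMap.mulLeft ℝ (C (MvPolynomial.X j)) ∘ₗ markedHam α β
      + LinearMap.mulLeft ℝ (C (ham α β (MvPolynomial.X j)))
      + (α * (j + 1)) • markedShift j from LinearMap.congr_fun h g
  refine marked_ext fun g i => ?_
  simp only [LinearMap.comp_apply, LinearMap.mulLeft_apply, LinearMap.add_apply,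
    LinearMap.smul_apply]
  rw [← mul_assoc, ← C_mul, markedHam_apply, markedHam_apply, markedShift_apply, ham_mul_var,
    ← shiftDer_apply, mark_mul, mark_X, ham_var]
  simp only [Algebra.smul_def, map_mul, map_add, map_one, map_natCast,
    Polynomial.algebraMap_apply, MvPolynomial.algebraMap_eq]
  ring

theorem markedShift_mul_var (j k : ℕ) (g : Fock[X]) :
    markedShift j (C (MvPolynomial.X k) * g) = C (MvPolynomial.X k) * markedShift j g
      + ((k : ℝ) + 1) • (C (MvPolynomial.X (j + k + 1)) * g) := by
  suffices h : markedShift j ∘ₗ LinearMap.mulLeft ℝ (C (MvPolynomial.X k)) =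
      LinearMap.mulLeft ℝ (C (MvPolynomial.X k)) ∘ₗ markedShift j
      + ((k : ℝ) + 1) • LinearMap.mulLeft ℝ (C (MvPolynomial.X (j + k + 1))) from
    LinearMap.congr_fun h g
  refine marked_ext fun g i => ?_
  simp only [LinearMap.comp_apply, LinearMap.mulLeft_apply, LinearMap.add_apply,
    LinearMap.smul_apply]
  rw [← mul_assoc, ← C_mul, markedShift_apply, markedShift_apply, shiftDer_mul_var]
  simp only [Algebra.smul_def, map_mul, map_add, map_one, map_natCast,
    MvPolynomial.algebraMap_eq]
  ring

/-- `mark` intertwines the shift derivations up to a first order correction. -/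
theorem markedShift_mark (j : ℕ) (f : Fock) :
    markedShift j (X * mark f) + (j : ℝ) • (X ^ (j + 2) * mark f) = X * mark (shiftDer j f) := by
  induction f using MvPolynomial.induction_on with
  | C a =>
    have : shiftDer j (MvPolynomial.C a) = 0 := by simp [shiftDer_apply]
    simp [this]
  | add p q hp hq =>
    simp only [map_add, mul_add, smul_add, ← hp, ← hq]
    abel
  | mul_X f k ih =>
    have h : X * (C f * (((k : Fock[X]) + 1) * X ^ k)) =
        ((k : ℝ) + 1) • (C f * X ^ (k + 1)) := by
      simp only [Algebra.smul_def, map_add, map_one, map_natCast]; ring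
    rw [mul_comm f, shiftDer_mul_var, map_add, Derivation.map_smul, mark_mul, mark_mul, mark_mul,
      mark_X, mark_X, mul_add, map_add, mul_left_comm X, markedShift_mul_var, h, map_smul,
      markedShift_apply]
    simp only [Algebra.smul_def, map_add, map_one, map_natCast] at ih ⊢
    push_cast
    linear_combination C (MvPolynomial.X k) * ih

end Fock

section Fock2

open Polynomial

theorem mark_ham_var (α β : ℝ) (j : ℕ) :
    mark (ham α β (MvPolynomial.X j)) = ((j : ℝ) + 1) • splitAll β j := by
  have h : mark (forget (splitPoly β j)) = (2 : ℝ) • splitAll β j := by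
    rw [forget_splitPoly, map_add, map_sum, Derivation.map_smul, mark_X]
    simp only [mark_mul, mark_X]
    rw [sum_add_distrib, splitAll, smul_add]
    have h1 : ∑ k ∈ range j, C (MvPolynomial.X k) *
        ((((j - (k + 1) : ℕ) : Fock[X]) + 1) * X ^ (j - (k + 1))) =
        ∑ k ∈ range j, ((k : Fock[X]) + 1) * (X ^ k * C (MvPolynomial.X (j - (k + 1)))) := by
      rw [← sum_range_reflect]
      refine sum_congr rfl fun k hk => ?_
      rw [mem_range] at hk
      rw [show j - (j - 1 - k + 1) = k by omega, show j - 1 - k = j - (k + 1) by omega]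
      ring
    have h2 : ∑ k ∈ range j, C (MvPolynomial.X (j - (k + 1))) * (((k : Fock[X]) + 1) * X ^ k) =
        ∑ k ∈ range j, ((k : Fock[X]) + 1) * (X ^ k * C (MvPolynomial.X (j - (k + 1)))) :=
      sum_congr rfl fun k _ => by ring
    rw [h1, h2, two_smul ℝ (∑ k ∈ range j, _)]
    congr 1
    rw [show (j : Fock[X]) + 1 = algebraMap ℝ _ ((j : ℝ) + 1) by simp, ← Algebra.smul_def,
      smul_smul, smul_smul]
    congr 1
    ring
  rw [ham_var, Derivation.map_smul, h, smul_smul]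
  congr 1
  ring

theorem ham_mul_var' (α β : ℝ) (j : ℕ) (f : Fock) :
    ham α β (MvPolynomial.X j * f) = MvPolynomial.X j * ham α β f
      + f * ham α β (MvPolynomial.X j) + (α * (j + 1)) • shiftDer j f := by
  rw [ham_mul_var, ham_var, mul_smul_comm, shiftDer_apply]

theorem markedHam_lax_C (α β : ℝ) (f : Fock) :
    markedHam α β (lax α β (C f)) = lax α β (markedHam α β (C f)) := by
  induction f using MvPolynomial.induction_on with
  | C a => 
    rw [markedHam_C, map_add, lax_C]
    have : ham α β (MvPolynomial.C a) = 0 := by simp [ham]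
    simp [this]
  | add p q hp hq => simp only [map_add, hp, hq]
  | mul_X f j ih =>
    have hS := markedShift_mark j f
    have h1 : markedHam α β (C (MvPolynomial.X j) * lax α β (C f)
        + (α * (j + 1)) • (C f * X ^ (j + 1))) =
        C (MvPolynomial.X j) * lax α β (markedHam α β (C f))
        + C (ham α β (MvPolynomial.X j)) * lax α β (C f)
        + (α * (j + 1)) • markedShift j (lax α β (C f))
        + (α * (j + 1)) • (C (ham α β f) * X ^ (j + 1)
          + (α * (j + 2)) • (X ^ (j + 2) * mark f)
          + C f * (X * splitAll β j + splitPoly β (j + 1))) := by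
      rw [map_add, map_smul, markedHam_mul_var, markedHam_apply, ih, splitAll_succ]
      push_cast
      ring_nf
    have h2 : lax α β (C (ham α β (MvPolynomial.X j * f))) =
        C (MvPolynomial.X j) * lax α β (C (ham α β f))
        + (α * (j + 1)) • (C (ham α β f) * X ^ (j + 1))
        + α • (X * (C f * (((j : ℝ) + 1) • splitAll β j)))
        + C (ham α β (MvPolynomial.X j)) * lax α β (C f)
        + (α * (j + 1)) • lax α β (C (shiftDer j f)) := by
      rw [← mark_ham_var α β j, ham_mul_var', lax_C, map_add, map_add, mark_mul, mark_mul, mark_X,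
        Derivation.map_smul, lax_C, lax_C, lax_C]
      simp only [Algebra.smul_def, map_mul, map_add, map_one, map_natCast]
      ring
    have h3 : lax α β (C (MvPolynomial.X j) * lax α β (C f)
        + (α * (j + 1)) • (C f * X ^ (j + 1))) =
        C (MvPolynomial.X j) * lax α β (lax α β (C f))
        + (α * (j + 1)) • (X ^ (j + 1) * lax α β (C f))
        + (α * (j + 1)) • (α • (X ^ (j + 2) * mark f) + C f * splitPoly β (j + 1)) := by
      rw [map_add, map_smul, lax_mul_var, lax_apply]
    rw [mul_comm f, markedHam_C, map_add, h2, C_mul, lax_mul_var,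
      mul_comm (X ^ (j + 1)) (C f), h1, h3, markedHam_C, lax_C α β (shiftDer j f), ← hS, lax_C,
      map_smul, map_add]
    simp only [Algebra.smul_def, map_mul, map_add, map_one, map_natCast, map_ofNat]
    ring

theorem markedHam_lax_mul_X {α β : ℝ} {g : Fock[X]}
    (h : markedHam α β (lax α β g) = lax α β (markedHam α β g)) :
    markedHam α β (lax α β (X * g)) = lax α β (markedHam α β (X * g)) := by
  have hf : forget (markedHam α β g) = ham α β (forget g) :=
    LinearMap.congr_fun (forget_markedHam α β) g
  have h1 : markedHam α β (lax α β (X * g)) = X * lax α β (markedHam α β g)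
      + lax α β (X * lax α β g) + (C (ham α β (forget g)) + lax α β (C (forget g)))
      + β • (X * markedHam α β g + lax α β (X * g)) := by
    rw [lax_mul_X, map_add, map_add, map_smul, markedHam_mul_X, markedHam_C, markedHam_mul_X, h,
      ← lax_mul_X]
  have h2 : lax α β (lax α β (X * g)) = lax α β (X * lax α β g) + lax α β (C (forget g))
      + β • lax α β (X * g) := by
    rw [lax_mul_X, map_add, map_add, map_smul, ← lax_mul_X]
  rw [h1, markedHam_mul_X, map_add, lax_mul_X α β (markedHam α β g), hf, h2]
  module

theorem markedHam_lax (α β : ℝ) (g : Fock[X]) :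
    markedHam α β (lax α β g) = lax α β (markedHam α β g) := by
  suffices h : markedHam α β ∘ₗ lax α β = lax α β ∘ₗ markedHam α β from
    LinearMap.congr_fun h g
  refine marked_ext fun f i => ?_
  simp only [LinearMap.comp_apply]
  induction i with
  | zero => simpa using markedHam_lax_C α β f
  | succ i ih =>
    rw [show C f * X ^ (i + 1) = X * (C f * X ^ i) by ring]
    generalize C f * X ^ i = g at ih
    exact markedHam_lax_mul_X ih

end Fock2

section Fock3

open Polynomial

/-- The coefficient of the zeroth power of the mark. -/
noncomputable def unmarked : Fock[X] →ₗ[ℝ] Fock := (lcoeff Fock 0).restrictScalars ℝ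

/-- The creation operators, obtained from powers of the Lax operator. -/
noncomputable def creation (α β : ℝ) (k : ℕ) : Module.End ℝ Fock :=
  forget ∘ₗ (lax α β ^ k) ∘ₗ markedFix

/-- The integrals of motion, obtained from powers of the Lax operator. -/
noncomputable def integral (α β : ℝ) (k : ℕ) : Module.End ℝ Fock :=
  unmarked ∘ₗ (lax α β ^ k) ∘ₗ markedFix

@[simp] theorem unmarked_apply (g : Fock[X]) : unmarked g = g.coeff 0 := rfl

theorem forget_C (f : Fock) : forget (C f) = MvPolynomial.X 0 * f := by
  have h := forget_mul f (X ^ 0)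
  rwa [forget_X_pow, pow_zero, mul_one, mul_comm] at h

theorem creation_zero (α β : ℝ) : creation α β 0 = LinearMap.mulLeft ℝ (MvPolynomial.X 0) := by
  refine LinearMap.ext fun f => ?_
  simp [creation, forget_C]

theorem integral_zero (α β : ℝ) : integral α β 0 = 1 := by
  refine LinearMap.ext fun f => ?_
  simp [integral]

theorem integral_one (α β : ℝ) : integral α β 1 = 0 := by
  refine LinearMap.ext fun f => ?_
  simp [integral, lax_C]

theorem markedHam_commute_lax (α β : ℝ) : Commute (markedHam α β) (lax α β) :=
  LinearMap.ext fun g => markedHam_lax α β g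

theorem markedHam_lax_pow (α β : ℝ) (k : ℕ) (g : Fock[X]) :
    markedHam α β ((lax α β ^ k) g) = (lax α β ^ k) (markedHam α β g) :=
  LinearMap.congr_fun ((markedHam_commute_lax α β).pow_right k) g

theorem creation_succ (α β : ℝ) (k : ℕ) :
    creation α β (k + 1) = ham α β * creation α β k - creation α β k * ham α β := by
  refine LinearMap.ext fun f => ?_
  have h := LinearMap.congr_fun (forget_markedHam α β) ((lax α β ^ k) (C f))
  simp only [LinearMap.comp_apply, markedHam_lax_pow, markedHam_C, map_add] at h
  rw [← Module.End.mul_apply (lax α β ^ k), ← pow_succ] at h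
  simp only [creation, LinearMap.sub_apply, Module.End.mul_apply, LinearMap.comp_apply,
    markedFix_apply]
  rw [← h]
  abel

theorem unmarked_markedHam (α β : ℝ) (g : Fock[X]) :
    unmarked (markedHam α β g) = ham α β (unmarked g) + unmarked (lax α β g) := by
  rw [← divX_mul_X_add g, mul_comm]
  simp only [map_add, markedHam_mul_X, markedHam_C]
  simp
  ring

/-- Operators on marked states on which `markedHam - lax` acts from the left as
`markedHam` acts from the right. -/
def Dressed (α β : ℝ) (G : Module.End ℝ Fock[X]) : Prop :=
  markedHam α β * G = G * markedHam α β + lax α β * G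

theorem Dressed.mul_lax {α β : ℝ} {G : Module.End ℝ Fock[X]} (h : Dressed α β G) :
    Dressed α β (G * lax α β) := by
  rw [Dressed] at h ⊢
  rw [← mul_assoc, h, add_mul, mul_assoc, mul_assoc, mul_assoc, (markedHam_commute_lax α β).eq]

theorem Dressed.lax_mul {α β : ℝ} {G : Module.End ℝ Fock[X]} (h : Dressed α β G) :
    Dressed α β (lax α β * G) := by
  rw [Dressed] at h ⊢
  rw [← mul_assoc, (markedHam_commute_lax α β).eq, mul_assoc, h, mul_add, mul_assoc]

theorem Dressed.add {α β : ℝ} {G H : Module.End ℝ Fock[X]} (hG : Dressed α β G)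
    (hH : Dressed α β H) : Dressed α β (G + H) := by
  rw [Dressed] at hG hH ⊢
  rw [mul_add, hG, hH, mul_add, add_mul]
  abel

theorem Dressed.smul {α β : ℝ} {G : Module.End ℝ Fock[X]} (h : Dressed α β G) (a : ℝ) :
    Dressed α β (a • G) := by
  rw [Dressed] at h ⊢
  rw [mul_smul_comm, h, smul_add, mul_smul_comm, smul_mul_assoc]

/-- The matrix element of an operator between unmarked states. -/
noncomputable def sandwich : Module.End ℝ Fock[X] →ₗ[ℝ] Module.End ℝ Fock where
  toFun G := unmarked ∘ₗ G ∘ₗ markedFix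
  map_add' G H := LinearMap.ext fun f => by simp
  map_smul' a G := LinearMap.ext fun f => by simp

theorem sandwich_apply (G : Module.End ℝ Fock[X]) (f : Fock) :
    sandwich G f = unmarked (G (C f)) := rfl

theorem Dressed.sandwich {α β : ℝ} {G : Module.End ℝ Fock[X]} (h : Dressed α β G) :
    ham α β * sandwich G - sandwich G * ham α β = sandwich (G * lax α β) := by
  refine LinearMap.ext fun f => ?_
  have h1 := LinearMap.congr_fun h (C f)
  have h2 := unmarked_markedHam α β (G (C f))
  simp only [Module.End.mul_apply, LinearMap.add_apply, markedHam_C, map_add] at h1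
  rw [h1, map_add, map_add] at h2
  simp only [LinearMap.sub_apply, Module.End.mul_apply, sandwich_apply]
  rw [← add_right_cancel h2]
  abel

/-- Multiplication by the marking variable. -/
noncomputable def markMul : Module.End ℝ Fock[X] := LinearMap.mulLeft ℝ X

/-- Multiplication by the variable `X 0`. -/
noncomputable def fixMul : Module.End ℝ Fock[X] := LinearMap.mulLeft ℝ (C (MvPolynomial.X 0))

theorem markMul_apply (g : Fock[X]) : markMul g = X * g := rfl

theorem fixMul_apply (g : Fock[X]) : fixMul g = C (MvPolynomial.X 0) * g := rfl

theorem dressed_lax_pow_mul_markMul (α β : ℝ) (k : ℕ) : Dressed α β (lax α β ^ k * markMul) := by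
  induction k with
  | zero =>
    refine LinearMap.ext fun g => ?_
    simp [markMul, markedHam_mul_X]
  | succ k ih =>
    rw [pow_succ', mul_assoc]
    exact ih.lax_mul

theorem pow_succ_comm_of_comm {R : Type*} [Ring R] [Algebra ℝ R] {L F w : R} {α : ℝ}
    (h : L * F = F * L + α • w) (k : ℕ) :
    L ^ (k + 1) * F - F * L ^ (k + 1) = (L ^ k * F - F * L ^ k) * L + α • (L ^ k * w) := by
  rw [pow_succ, mul_assoc, h, mul_add, mul_smul_comm, sub_mul]
  simp only [mul_assoc]
  abel

theorem lax_pow_succ_comm_fixMul (α β : ℝ) (k : ℕ) :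
    lax α β ^ (k + 1) * fixMul - fixMul * lax α β ^ (k + 1) =
      (lax α β ^ k * fixMul - fixMul * lax α β ^ k) * lax α β
        + α • (lax α β ^ k * markMul) := by
  have h : lax α β * fixMul = fixMul * lax α β + α • markMul := by
    refine LinearMap.ext fun g => ?_
    simpa [markMul_apply, fixMul_apply] using lax_mul_var α β 0 g
  exact pow_succ_comm_of_comm (R := Module.End ℝ Fock[X]) h k

theorem dressed_comm_fixMul (α β : ℝ) (k : ℕ) :
    Dressed α β (lax α β ^ k * fixMul - fixMul * lax α β ^ k) := by
  induction k with
  | zero =>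
    have h : lax α β ^ 0 * fixMul - fixMul * lax α β ^ 0 = 0 := by
      rw [pow_zero, one_mul, mul_one]
      exact sub_self fixMul
    rw [h, Dressed, mul_zero, zero_mul, mul_zero, add_zero]
  | succ k ih =>
    rw [lax_pow_succ_comm_fixMul]
    exact ih.mul_lax.add ((dressed_lax_pow_mul_markMul α β k).smul α)

theorem integral_eq (α β : ℝ) (k : ℕ) : integral α β k = sandwich (lax α β ^ k) := rfl

theorem ham_comm_integral (α β : ℝ) (k : ℕ) :
    ham α β * integral α β k = integral α β k * ham α β := by
  refine LinearMap.ext fun f => ?_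
  have h := unmarked_markedHam α β ((lax α β ^ k) (C f))
  rw [markedHam_lax_pow, markedHam_C, map_add, map_add, ← Module.End.mul_apply, ← pow_succ,
    pow_succ', Module.End.mul_apply] at h
  exact (add_right_cancel h).symm

theorem integral_comm_fix (α β : ℝ) (k : ℕ) :
    integral α β k * LinearMap.mulLeft ℝ (MvPolynomial.X 0)
      - LinearMap.mulLeft ℝ (MvPolynomial.X 0) * integral α β k =
      sandwich (lax α β ^ k * fixMul - fixMul * lax α β ^ k) := by
  refine LinearMap.ext fun f => ?_
  simp [integral, sandwich_apply, fixMul]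

theorem sandwich_markMul_succ (α β : ℝ) (k : ℕ) :
    sandwich (lax α β ^ (k + 1) * markMul) = sandwich (lax α β ^ k * markMul * lax α β)
      + integral α β k * LinearMap.mulLeft ℝ (MvPolynomial.X 0)
      + β • sandwich (lax α β ^ k * markMul) := by
  refine LinearMap.ext fun f => ?_
  simp only [pow_succ, LinearMap.add_apply, LinearMap.smul_apply, sandwich_apply,
    Module.End.mul_apply, markMul_apply, integral_eq, lax_mul_X, map_add, map_smul, forget_C,
    LinearMap.mulLeft_apply]

theorem integral_recurrence (α β : ℝ) (k : ℕ) (c : ℕ → Module.End ℝ Fock)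
    (hc : ∀ k, c k = integral α β k * LinearMap.mulLeft ℝ (MvPolynomial.X 0)
      - LinearMap.mulLeft ℝ (MvPolynomial.X 0) * integral α β k) :
    c (k + 2) = (2 : ℝ) • (ham α β * c (k + 1) - c (k + 1) * ham α β) + β • c (k + 1)
      - (ham α β * (ham α β * c k - c k * ham α β) - (ham α β * c k - c k * ham α β) * ham α β)
      - β • (ham α β * c k - c k * ham α β)
      + α • (integral α β k * LinearMap.mulLeft ℝ (MvPolynomial.X 0)) := by
  have hc' : ∀ k, c k = sandwich (lax α β ^ k * fixMul - fixMul * lax α β ^ k) := fun k => by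
    rw [hc, integral_comm_fix]
  have ha := fun k => (dressed_comm_fixMul α β k).sandwich
  have ha2 := fun k => (dressed_comm_fixMul α β k).mul_lax.sandwich
  have hu := fun k => (dressed_lax_pow_mul_markMul α β k).sandwich
  have hs : ∀ k, c (k + 1) = sandwich ((lax α β ^ k * fixMul - fixMul * lax α β ^ k) * lax α β)
      + α • sandwich (lax α β ^ k * markMul) := fun k => by
    rw [hc', lax_pow_succ_comm_fixMul, map_add, map_smul]
  simp only [← hc'] at ha
  have h1 : c (k + 2) = (ham α β * c (k + 1) - c (k + 1) * ham α β)
      + α • sandwich (lax α β ^ (k + 1) * markMul) := by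
    rw [hs (k + 1), ← ha]
  have h2 : α • sandwich (lax α β ^ k * markMul) =
      c (k + 1) - (ham α β * c k - c k * ham α β) := by
    rw [hs k, ← ha]; abel
  have h3 : α • sandwich (lax α β ^ k * markMul * lax α β) =
      (ham α β * c (k + 1) - c (k + 1) * ham α β) -
      (ham α β * (ham α β * c k - c k * ham α β)
        - (ham α β * c k - c k * ham α β) * ham α β) := by
    rw [← hu, smul_sub, ← mul_smul_comm, ← smul_mul_assoc, h2, mul_sub, sub_mul]
    abel
  rw [h1, sandwich_markMul_succ, smul_add, smul_add, smul_comm α β, h2, h3]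
  module

/-- Evaluation at the identity permutation: `p_1 ↦ 1` and `p_k ↦ 0` for `k ≥ 2`. -/
noncomputable def evalOne : Fock →ₐ[ℝ] ℝ := MvPolynomial.aeval fun i => if i = 0 then 1 else 0

theorem evalOne_forget (g : Fock[X]) : evalOne (forget g) = evalOne (unmarked g) := by
  suffices h : evalOne.toLinearMap ∘ₗ forget = evalOne.toLinearMap ∘ₗ unmarked from
    LinearMap.congr_fun h g
  refine marked_ext fun f i => ?_
  by_cases hi : i = 0
  · simp [forget_C, evalOne, hi]
  · simp [forget_mul, evalOne, coeff_X_pow, hi, Ne.symm hi]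

theorem ham_apply_one (α β : ℝ) : ham α β 1 = 0 := ham_one α β

theorem integral_apply_one (α β : ℝ) (k : ℕ) : integral α β k 1 = (0 : ℝ) ^ k • 1 := by
  cases k with
  | zero => simp [integral_zero]
  | succ k => simp [integral, pow_succ, lax_C, -map_one]

end Fock3

section Shapes

/-- Row lengths of a partition of `n`. -/
def IsShape (n : ℕ) (f : ℕ → ℕ) : Prop := Antitone f ∧ ∑ i ∈ range n, f i = n ∧ f n = 0

theorem lt_card_filter_lt_iff {g : ℕ → ℕ} (hg : Antitone g) {N : ℕ} (hN : g N = 0) (i j : ℕ) :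
    j < #{j ∈ range N | i < g j} ↔ i < g j := by
  have hex : ∃ m, ¬ i < g m := ⟨N, by omega⟩
  have hS : {j ∈ range N | i < g j} = range (Nat.find hex) := by
    ext k
    simp only [mem_filter, mem_range, Nat.lt_find_iff, not_not]
    refine ⟨fun h l hl => h.2.trans_le (hg hl), fun h => ⟨?_, h k le_rfl⟩⟩
    by_contra hk
    have h1 := h k le_rfl
    have h2 := hg (not_lt.1 hk)
    omega
  rw [hS, card_range, Nat.lt_find_iff]
  simp only [not_not]
  exact ⟨fun h => h j le_rfl, fun h l hl => h.trans_le (hg hl)⟩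

variable {n : ℕ} (lam : n.Partition)

theorem colLen_antitone : Antitone (colLen lam) := fun _ _ h =>
  Multiset.card_le_card (Multiset.monotone_filter_right _ fun _ hp => lt_of_le_of_lt h hp)

theorem colLen_eq_zero {j : ℕ} (hj : n ≤ j) : colLen lam j = 0 := by
  rw [colLen, Multiset.card_eq_zero, Multiset.filter_eq_nil]
  intro p hp
  have := Multiset.le_sum_of_mem hp
  rw [lam.parts_sum] at this
  omega

theorem lt_rowLen_iff (i j : ℕ) : j < rowLen lam i ↔ i < colLen lam j :=
  lt_card_filter_lt_iff (colLen_antitone lam) (colLen_eq_zero lam le_rfl) i j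

theorem rowLen_antitone : Antitone (rowLen lam) := fun _ _ h =>
  card_le_card (monotone_filter_right _ fun _ _ hj => lt_of_le_of_lt h hj)

theorem colLen_le : ∀ j, colLen lam j ≤ n := fun j => by
  refine (Multiset.card_le_card (Multiset.filter_le _ _)).trans ?_
  have h := Multiset.card_nsmul_le_sum (s := lam.parts) (a := 1) fun p hp => lam.parts_pos hp
  rw [lam.parts_sum] at h
  simpa using h

theorem rowLen_le (i : ℕ) : rowLen lam i ≤ n := by
  simpa [rowLen] using card_filter_le (range n) (fun j => i < colLen lam j)

theorem rowLen_self : rowLen lam n = 0 := by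
  by_contra h
  have := (lt_rowLen_iff lam n 0).1 (by omega)
  have := colLen_le lam 0
  omega

theorem sum_map_colLen (g : ℕ → ℕ) :
    ∑ j ∈ range n, g j * colLen lam j = (lam.parts.map fun p => ∑ j ∈ range p, g j).sum := by
  have h : ∀ s : Multiset ℕ, (∀ p ∈ s, p ≤ n) →
      ∑ j ∈ range n, g j * (s.filter (fun p => j < p)).card =
      (s.map fun p => ∑ j ∈ range p, g j).sum := by
    intro s
    induction s using Multiset.induction_on with
    | empty => simp
    | cons p s ih =>
      intro hs
      rw [Multiset.map_cons, Multiset.sum_cons, ← ih fun q hq => hs q (Multiset.mem_cons_of_mem hq)]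
      have hp := hs p (Multiset.mem_cons_self _ _)
      have h1 : ∑ j ∈ range p, g j = ∑ j ∈ range n, if j < p then g j else 0 := by
        rw [← sum_filter]
        congr 1
        ext j
        simp
        omega
      rw [h1, ← sum_add_distrib]
      refine sum_congr rfl fun j _ => ?_
      by_cases hj : j < p
      · simp [hj]
        ring
      · simp [hj]
  refine h _ fun p hp => ?_
  have := Multiset.le_sum_of_mem hp
  rwa [lam.parts_sum] at this

theorem sum_rowLen_comm (g : ℕ → ℕ → ℝ) :
    ∑ i ∈ range n, ∑ j ∈ range (rowLen lam i), g i j =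
      ∑ j ∈ range n, ∑ i ∈ range (colLen lam j), g i j := by
  refine sum_comm' fun i j => ?_
  simp only [mem_range, lt_rowLen_iff]
  have := colLen_le lam j
  have := rowLen_le lam i
  have := lt_rowLen_iff lam i j
  omega

theorem isShape_rowLen : IsShape n (rowLen lam) := by
  refine ⟨rowLen_antitone lam, ?_, rowLen_self lam⟩
  have h := sum_rowLen_comm lam fun _ _ => 1
  have h2 := sum_map_colLen lam fun _ => 1
  simp only [sum_const, card_range, nsmul_eq_mul, mul_one, ← Nat.cast_sum, one_mul, smul_eq_mul,
    Nat.cast_inj, Multiset.map_id', lam.parts_sum] at h h2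
  rw [h, h2]

theorem rowLen_injective : Function.Injective (rowLen (n := n)) := by
  intro a b hab
  have hc : ∀ j, colLen a j = colLen b j := fun j => eq_of_forall_lt_iff fun i => by
    rw [← lt_rowLen_iff, ← lt_rowLen_iff, hab]
  have hcount : ∀ (c : n.Partition) (p : ℕ),
      colLen c p = colLen c (p + 1) + c.parts.count (p + 1) := by
    intro c p
    rw [colLen, colLen, Multiset.count_eq_card_filter_eq, ← Multiset.card_add]
    congr 1
    ext q
    simp only [Multiset.count_add, Multiset.count_filter]
    grind
  refine Nat.Partition.ext (Multiset.ext.2 fun p => ?_)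
  cases p with
  | zero =>
    rw [Multiset.count_eq_zero_of_notMem fun h => (a.parts_pos h).ne' rfl,
      Multiset.count_eq_zero_of_notMem fun h => (b.parts_pos h).ne' rfl]
  | succ p =>
    have h1 := hcount a p
    have h2 := hcount b p
    rw [hc, hc] at h1
    omega

theorem exists_rowLen_eq {f : ℕ → ℕ} (hf : IsShape n f) : ∃ lam : n.Partition, rowLen lam = f := by
  have hs : ((range n).val.map f).sum = n := hf.2.1
  refine ⟨Nat.Partition.ofSums n ((range n).val.map f) hs, ?_⟩
  have hc : ∀ j, colLen (Nat.Partition.ofSums n ((range n).val.map f) hs) j =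
      #{i ∈ range n | j < f i} := by
    intro j
    rw [colLen, Nat.Partition.ofSums_parts, Multiset.filter_filter, Multiset.filter_map,
      Multiset.card_map]
    rw [card_def, filter_val]
    congr 1
    refine Multiset.filter_congr fun i _ => ?_
    simp only [Function.comp]
    omega
  funext i
  refine eq_of_forall_lt_iff fun j => ?_
  rw [lt_rowLen_iff, hc, lt_card_filter_lt_iff hf.1 hf.2.2]

/-- The shapes of size `n`. -/
def shapes (n : ℕ) : Finset (ℕ → ℕ) := univ.map ⟨rowLen (n := n), rowLen_injective⟩

theorem mem_shapes {f : ℕ → ℕ} : f ∈ shapes n ↔ IsShape n f := by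
  simp only [shapes, mem_map, mem_univ, true_and, Function.Embedding.coeFn_mk]
  exact ⟨fun ⟨lam, h⟩ => h ▸ isShape_rowLen lam, exists_rowLen_eq⟩

theorem nStatConj_eq : nStatConj lam = (lam.parts.map fun p => p.choose 2).sum := by
  rw [nStatConj, sum_map_colLen lam fun j => j]
  congr 1
  refine Multiset.map_congr rfl fun p _ => ?_
  rw [sum_range_id, Nat.choose_two_right]

theorem sub_nStat_eq (α : ℝ) : α * nStatConj lam - nStat lam =
    ∑ i ∈ range n, (α * ((rowLen lam i).choose 2) - i * rowLen lam i) := by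
  have h := sum_rowLen_comm lam fun _ j => j
  have hr : ∀ p : ℕ, ∑ j ∈ range p, (j : ℝ) = p.choose 2 := fun p => by
    rw [← Nat.cast_sum, sum_range_id, Nat.choose_two_right]
  simp only [hr, sum_const, card_range, nsmul_eq_mul] at h
  rw [sum_sub_distrib, ← mul_sum, h, nStat, nStatConj]
  push_cast
  simp only [mul_comm (colLen lam _ : ℝ)]

end Shapes

section Hooks

/-- The product of `u` consecutive hook lengths in a row, along columns reaching `d` rows. -/
noncomputable def hookRun (α t : ℝ) (d u : ℕ) : ℝ := ∏ s ∈ range u, (α * s + d - 1 + t)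

/-- The product of the hook lengths in row `i`, for a shape with at most `m` rows. -/
noncomputable def rowHook (α t : ℝ) (m : ℕ) (f : ℕ → ℕ) (i : ℕ) : ℝ :=
  hookRun α t (m - i) (f i) * ∏ k ∈ Ico (i + 1) m,
    hookRun α t (k - i) (f i - f k) / hookRun α t (k - i + 1) (f i - f k)

variable {α t : ℝ}

theorem hookRun_pos (hα : 0 < α) (ht : 0 < t) {d : ℕ} (hd : 1 ≤ d) (u : ℕ) :
    0 < hookRun α t d u := by
  refine prod_pos fun s _ => ?_
  have : (1 : ℝ) ≤ d := by exact_mod_cast hd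
  have : 0 ≤ α * s := by positivity
  linarith

theorem hookRun_succ (d u : ℕ) :
    hookRun α t d (u + 1) = hookRun α t d u * (α * u + d - 1 + t) := prod_range_succ _ _

theorem rowHook_pos (hα : 0 < α) (ht : 0 < t) {m i : ℕ} (hi : i < m) (f : ℕ → ℕ) :
    0 < rowHook α t m f i := by
  refine mul_pos (hookRun_pos hα ht (by omega) _) (prod_pos fun k hk => ?_)
  rw [mem_Ico] at hk
  exact div_pos (hookRun_pos hα ht (by omega) _) (hookRun_pos hα ht (by omega) _)

theorem prod_Ico_hook (hα : 0 < α) (ht : 0 < t) {f col : ℕ → ℕ} (hf : Antitone f)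
    (hcol : ∀ i j, i < col j ↔ j < f i) {i k : ℕ} (hik : i ≤ k) :
    ∏ j ∈ Ico (f (k + 1)) (f k),
      (α * (f i - (j + 1) : ℕ) + (col j - (i + 1) : ℕ) + t) =
    hookRun α t (k + 1 - i) (f i - f (k + 1)) / hookRun α t (k + 1 - i) (f i - f k) := by
  have h1 := hf k.le_succ
  have h2 := hf hik
  simp only [Nat.succ_eq_add_one] at h1
  rw [eq_div_iff (hookRun_pos hα ht (by omega) _).ne', mul_comm]
  have h3 : ∏ j ∈ Ico (f (k + 1)) (f k),
      (α * (f i - (j + 1) : ℕ) + (col j - (i + 1) : ℕ) + t) =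
      ∏ s ∈ Ico (f i - f k) (f i - f (k + 1)), (α * s + (k + 1 - i : ℕ) - 1 + t) := by
    refine prod_bij' (fun j _ => f i - (j + 1)) (fun s _ => f i - (s + 1)) ?_ ?_ ?_ ?_ ?_
    · intro j hj; rw [mem_Ico] at *; omega
    · intro j hj; rw [mem_Ico] at *; omega
    · intro j hj; rw [mem_Ico] at *; omega
    · intro j hj; rw [mem_Ico] at *; omega
    · intro j hj
      rw [mem_Ico] at hj
      have hc : col j = k + 1 := by
        have e1 := hcol k j
        have e2 := hcol (k + 1) j
        omega
      rw [hc, show k + 1 - i = k + 1 - (i + 1) + 1 by omega]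
      push_cast
      ring
  rw [h3, hookRun, hookRun, prod_range_mul_prod_Ico _ (by omega)]

theorem prod_row_hook (hα : 0 < α) (ht : 0 < t) {f col : ℕ → ℕ} (hf : Antitone f)
    (hcol : ∀ i j, i < col j ↔ j < f i) {m : ℕ} (hm : f m = 0) {i : ℕ} (hi : i < m) :
    ∏ j ∈ range (f i), (α * (f i - (j + 1) : ℕ) + (col j - (i + 1) : ℕ) + t) =
      rowHook α t m f i := by
  suffices h : ∏ j ∈ Ico (f m) (f i), (α * (f i - (j + 1) : ℕ) + (col j - (i + 1) : ℕ) + t) =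
      hookRun α t (m - i) (f i - f m) * ∏ k ∈ Ico (i + 1) m,
        hookRun α t (k - i) (f i - f k) / hookRun α t (k - i + 1) (f i - f k) by
    rw [hm] at h
    rw [rowHook, range_eq_Ico, h, Nat.sub_zero]
  clear hm
  induction m, hi using Nat.le_induction with
  | base =>
    rw [prod_Ico_hook hα ht hf hcol le_rfl]
    simp [hookRun]
  | succ k hk ih =>
    have hpos := (hookRun_pos hα ht (show 1 ≤ k - i + 1 by omega) (f i - f k)).ne'
    rw [← prod_Ico_consecutive _ (hf k.le_succ) (hf (by omega : i ≤ k)), ih,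
      prod_Ico_hook hα ht hf hcol (by omega), prod_Ico_succ_top hk,
      show k + 1 - i = k - i + 1 by omega]
    field_simp

/-- The contents `α f_i - i`. -/
def content (α : ℝ) (f : ℕ → ℕ) (i : ℕ) : ℝ := α * f i - i

/-- Adds a box in row `r`. -/
def addBox (f : ℕ → ℕ) (r : ℕ) : ℕ → ℕ := Function.update f r (f r + 1)

theorem addBox_self (f : ℕ → ℕ) (r : ℕ) : addBox f r r = f r + 1 := by simp [addBox]

theorem addBox_of_ne (f : ℕ → ℕ) {r i : ℕ} (h : i ≠ r) : addBox f r i = f i := by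
  simp [addBox, h]

theorem rowHook_addBox_gt {f : ℕ → ℕ} {r m i : ℕ} (hi : r < i) :
    rowHook α t m (addBox f r) i = rowHook α t m f i := by
  rw [rowHook, rowHook, addBox_of_ne f hi.ne']
  congr 1
  refine prod_congr rfl fun k hk => ?_
  rw [mem_Ico] at hk
  rw [addBox_of_ne f (by omega)]

theorem rowHook_addBox_self {f : ℕ → ℕ} (hf : Antitone f) {r m : ℕ}
    (hr : r < m) : rowHook α t m (addBox f r) r = rowHook α t m f r *
      ((content α f r + m - 1 + t) * ∏ k ∈ Ico (r + 1) m,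
        (content α f r - content α f k - 1 + t) / (content α f r - content α f k + t)) := by
  have h : ∀ k ∈ Ico (r + 1) m, hookRun α t (k - r) (addBox f r r - addBox f r k) /
      hookRun α t (k - r + 1) (addBox f r r - addBox f r k) =
      hookRun α t (k - r) (f r - f k) / hookRun α t (k - r + 1) (f r - f k) *
      ((content α f r - content α f k - 1 + t) / (content α f r - content α f k + t)) := by
    intro k hk
    rw [mem_Ico] at hk
    have h1 := hf (by omega : r ≤ k)
    rw [addBox_self, addBox_of_ne f (by omega), Nat.sub_add_comm h1, hookRun_succ, hookRun_succ,
      mul_div_mul_comm]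
    congr 2
    · rw [content, content, Nat.cast_sub h1, Nat.cast_sub (by omega)]
      ring
    · rw [content, content, Nat.cast_sub h1, Nat.cast_add, Nat.cast_sub (by omega)]
      push_cast
      ring
  rw [rowHook, prod_congr rfl h, prod_mul_distrib, addBox_self, hookRun_succ, rowHook, content,
    Nat.cast_sub hr.le]
  ring

theorem rowHook_addBox_lt (hα : 0 < α) (ht : 0 < t) {f : ℕ → ℕ} {r m i : ℕ}
    (hr : r < m) (hi : i < r) (hri : f r < f i) :
    rowHook α t m (addBox f r) i = rowHook α t m f i *
      ((content α f i - content α f r - α + t) / (content α f i - content α f r - α - 1 + t)) := by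
  have hmem : r ∈ Ico (i + 1) m := by rw [mem_Ico]; omega
  rw [rowHook, rowHook, ← mul_prod_erase _ _ hmem, ← mul_prod_erase (Ico (i + 1) m) _ hmem,
    addBox_of_ne f hi.ne, addBox_self]
  have h : ∏ k ∈ (Ico (i + 1) m).erase r, hookRun α t (k - i) (f i - addBox f r k) /
      hookRun α t (k - i + 1) (f i - addBox f r k) = ∏ k ∈ (Ico (i + 1) m).erase r,
      hookRun α t (k - i) (f i - f k) / hookRun α t (k - i + 1) (f i - f k) := by
    refine prod_congr rfl fun k hk => ?_
    rw [addBox_of_ne f (ne_of_mem_erase hk)]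
  rw [h, show f i - f r = f i - (f r + 1) + 1 by omega, hookRun_succ, hookRun_succ]
  have e1 : content α f i - content α f r - α + t =
      α * (f i - (f r + 1) : ℕ) + (r - i + 1 : ℕ) - 1 + t := by
    rw [content, content, Nat.cast_sub (by omega), Nat.cast_add (r - i), Nat.cast_sub (by omega)]
    push_cast
    ring
  have e2 : content α f i - content α f r - α - 1 + t =
      α * (f i - (f r + 1) : ℕ) + (r - i : ℕ) - 1 + t := by
    rw [content, content, Nat.cast_sub (by omega), Nat.cast_sub (by omega)]
    push_cast
    ring
  have p1 : 0 < α * (f i - (f r + 1) : ℕ) + (r - i : ℕ) - 1 + t := by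
    have : (1 : ℝ) ≤ (r - i : ℕ) := by exact_mod_cast (by omega : 1 ≤ r - i)
    have : 0 ≤ α * (f i - (f r + 1) : ℕ) := by positivity
    linarith
  have p2 : 0 < α * (f i - (f r + 1) : ℕ) + (r - i + 1 : ℕ) - 1 + t := by
    push_cast
    linarith
  rw [e1, e2]
  have p3 := hookRun_pos hα ht (show 1 ≤ r - i by omega) (f i - (f r + 1))
  have p4 := hookRun_pos hα ht (show 1 ≤ r - i + 1 by omega) (f i - (f r + 1))
  field_simp

/-- The product of all hook lengths of a shape with at most `m` rows. -/
noncomputable def hookProd (α t : ℝ) (m : ℕ) (f : ℕ → ℕ) : ℝ := ∏ i ∈ range m, rowHook α t m f i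

theorem hookProd_pos (hα : 0 < α) (ht : 0 < t) (m : ℕ) (f : ℕ → ℕ) : 0 < hookProd α t m f :=
  prod_pos fun _ hi => rowHook_pos hα ht (mem_range.1 hi) f

theorem hookProd_addBox (hα : 0 < α) (ht : 0 < t) {f : ℕ → ℕ} (hf : Antitone f) {r m : ℕ}
    (hr : r < m) (hadd : ∀ i < r, f r < f i) :
    hookProd α t m (addBox f r) = hookProd α t m f *
      ((content α f r + m - 1 + t) * (∏ k ∈ Ico (r + 1) m,
        (content α f r - content α f k - 1 + t) / (content α f r - content α f k + t)) *
      ∏ i ∈ range r, (content α f i - content α f r - α + t) /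
        (content α f i - content α f r - α - 1 + t)) := by
  rw [hookProd, hookProd, ← prod_range_mul_prod_Ico _ hr.le, ← prod_range_mul_prod_Ico _ hr.le,
    prod_eq_prod_Ico_succ_bot hr, prod_eq_prod_Ico_succ_bot hr, rowHook_addBox_self hf hr,
    prod_congr rfl fun i hi =>
      rowHook_addBox_lt hα ht hr (mem_range.1 hi) (hadd i (mem_range.1 hi)),
    prod_mul_distrib, prod_congr rfl fun i hi =>
      rowHook_addBox_gt (Nat.lt_of_succ_le (mem_Ico.1 hi).1)]
  ring

theorem prod_cells {n : ℕ} (lam : n.Partition) (hα : 0 < α) (ht : 0 < t) {m : ℕ} (hm : n ≤ m) :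
    ∏ s ∈ cells lam, (α * arm lam s + leg lam s + t) = hookProd α t m (rowLen lam) := by
  have h : ∏ s ∈ cells lam, (α * arm lam s + leg lam s + t) =
      ∏ i ∈ range m, ∏ j ∈ range (rowLen lam i),
        (α * (rowLen lam i - (j + 1) : ℕ) + (colLen lam j - (i + 1) : ℕ) + t) := by
    refine prod_finset_product _ _ _ fun s => ?_
    simp only [cells, mem_filter, mem_product, mem_range]
    have h1 := rowLen_le lam s.1
    refine ⟨fun h => ⟨by omega, h.2⟩, fun h => ⟨⟨?_, by omega⟩, h.2⟩⟩
    by_contra hs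
    have h2 := rowLen_antitone lam (not_lt.1 hs)
    rw [rowLen_self] at h2
    omega
  rw [h, hookProd]
  refine prod_congr rfl fun i hi => prod_row_hook hα ht (rowLen_antitone lam)
    (fun i j => (lt_rowLen_iff lam i j).symm) ?_ (mem_range.1 hi)
  have h2 := rowLen_antitone lam hm
  rw [rowLen_self] at h2
  omega

theorem jackP_eq {n : ℕ} (lam : n.Partition) (hα : 0 < α) {m : ℕ} (hm : n ≤ m) :
    jackP α lam = α ^ n * n.factorial /
      (hookProd α 1 m (rowLen lam) * hookProd α α m (rowLen lam)) := by
  rw [jackP, cLow, cUp, prod_cells lam hα one_pos hm, prod_cells lam hα hα hm]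

end Hooks

section PartialFractions

open Polynomial

/-- The monic polynomial with roots `y 0, …, y (m - 1)`. -/
noncomputable def rootPoly (y : ℕ → ℝ) (m : ℕ) : ℝ[X] := ∏ k ∈ range m, (X - C (y k))

theorem rootPoly_succ (y : ℕ → ℝ) (m : ℕ) :
    rootPoly y (m + 1) = rootPoly y m * (X - C (y m)) := prod_range_succ _ _

theorem eval_rootPoly (y : ℕ → ℝ) (m : ℕ) (z : ℝ) :
    (rootPoly y m).eval z = ∏ k ∈ range m, (z - y k) := by
  simp [rootPoly, eval_prod]

theorem coeff_rootPoly_of_lt (y : ℕ → ℝ) {m k : ℕ} (h : m < k) : (rootPoly y m).coeff k = 0 :=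
  coeff_eq_zero_of_natDegree_lt (by simpa [rootPoly] using h)

theorem coeff_rootPoly_self (y : ℕ → ℝ) (m : ℕ) : (rootPoly y m).coeff m = 1 := by
  have h : (rootPoly y m).Monic := monic_prod_X_sub_C y (range m)
  have h2 : (rootPoly y m).natDegree = m := by simp [rootPoly]
  simpa [h2] using h.coeff_natDegree

theorem coeff_X_mul_rootPoly (y : ℕ → ℝ) (m : ℕ) :
    (X * rootPoly y m).coeff m = -∑ k ∈ range m, y k := by
  induction m with
  | zero => simp
  | succ m ih =>
    rw [rootPoly_succ, ← mul_assoc, coeff_mul_X_sub_C, ih, coeff_X_mul, coeff_rootPoly_self,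
      sum_range_succ]
    ring

theorem coeff_X_sq_mul_rootPoly (y : ℕ → ℝ) (m : ℕ) :
    (X * (X * rootPoly (fun k => y k + 1) m)).coeff m = (X * (X * rootPoly y m)).coeff m
      + (m - 1) * ∑ k ∈ range m, y k + m * (m - 1) / 2 := by
  induction m with
  | zero => simp
  | succ m ih =>
    have h : ∀ p q : ℝ[X], X * (X * (p * q)) = X * (X * p) * q := fun p q => by ring
    rw [rootPoly_succ, rootPoly_succ, h, h, coeff_mul_X_sub_C, coeff_mul_X_sub_C, ih, coeff_X_mul,
      coeff_X_mul, coeff_X_mul_rootPoly, coeff_X_mul_rootPoly, sum_range_succ, sum_add_distrib]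
    simp
    ring

/-- The transition weights attached to the contents `x`. -/
noncomputable def growWeight (x : ℕ → ℝ) (m i : ℕ) : ℝ :=
  (∏ k ∈ range m, (x i - x k + 1)) / ∏ k ∈ (range (m + 1)).erase i, (x i - x k)

/-- The moments of the transition weights. -/
noncomputable def growMoment (x : ℕ → ℝ) (m j : ℕ) : ℝ :=
  ∑ i ∈ range (m + 1), growWeight x m i * x i ^ j

theorem growMoment_zero {x : ℕ → ℝ} {m : ℕ} (hx : Set.InjOn x (range (m + 1))) :
    growMoment x m 0 = 1 := by
  have hd : (rootPoly (fun k => x k - 1) m).degree < #(range (m + 1)) := by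
    rw [degree_lt_iff_coeff_zero]
    intro k hk
    rw [card_range] at hk
    exact coeff_rootPoly_of_lt _ (by omega)
  have h := Lagrange.coeff_eq_sum hx hd
  rw [card_range, Nat.add_sub_cancel, coeff_rootPoly_self] at h
  rw [growMoment, h]
  refine sum_congr rfl fun i _ => ?_
  rw [eval_rootPoly, pow_zero, mul_one, growWeight]
  congr 1
  exact prod_congr rfl fun k _ => by ring

theorem growMoment_one {x : ℕ → ℝ} {m : ℕ} (hx : Set.InjOn x (range (m + 1))) (hm : x m = -m) :
    growMoment x m 1 = 0 := by
  set g : ℝ[X] := X * rootPoly (fun k => x k - 1) m - rootPoly x (m + 1) with hg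
  have hd : g.degree < #(range (m + 1)) := by
    rw [degree_lt_iff_coeff_zero]
    intro k hk
    rw [card_range] at hk
    obtain ⟨k, rfl⟩ : ∃ l, k = l + 1 := ⟨k - 1, by omega⟩
    rw [hg, coeff_sub, coeff_X_mul]
    rcases (show m ≤ k by omega).eq_or_lt with h | h
    · rw [← h, coeff_rootPoly_self, coeff_rootPoly_self, sub_self]
    · rw [coeff_rootPoly_of_lt _ h, coeff_rootPoly_of_lt _ (by omega), sub_self]
  have h := Lagrange.coeff_eq_sum hx hd
  have hc := coeff_X_mul_rootPoly x (m + 1)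
  rw [coeff_X_mul] at hc
  rw [card_range, Nat.add_sub_cancel, hg, coeff_sub, coeff_X_mul_rootPoly, hc, sum_range_succ, hm,
    sum_sub_distrib] at h
  simp only [sum_const, card_range, nsmul_eq_mul, mul_one] at h
  rw [growMoment]
  refine Eq.trans (sum_congr rfl fun i hi => ?_) (h.symm.trans (by ring))
  have h0 : ∏ k ∈ range (m + 1), (x i - x k) = 0 := prod_eq_zero hi (sub_self _)
  rw [eval_sub, eval_mul, eval_X, eval_rootPoly, eval_rootPoly, h0, sub_zero, pow_one, growWeight,
    mul_comm, mul_div_assoc]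
  congr 2
  exact prod_congr rfl fun k _ => by ring

/-- The partial fraction identity behind the backward transition weights. -/
theorem sum_shrinkWeight {y : ℕ → ℝ} {n : ℕ} (hy : Set.InjOn y (range (n + 1))) :
    ∑ r ∈ range (n + 1), (y r + n) * ∏ k ∈ (range (n + 1)).erase r,
      ((y r - y k - 1) / (y r - y k)) = ∑ r ∈ range (n + 1), y r + (n + 1) * n / 2 := by
  set g : ℝ[X] := (X - C 1) * rootPoly y (n + 1)
    - (X + C (n : ℝ)) * rootPoly (fun k => y k + 1) (n + 1) with hg
  have hd : g.degree < #(range (n + 1)) := by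
    rw [degree_lt_iff_coeff_zero]
    intro k hk
    rw [card_range] at hk
    rw [hg, coeff_sub, sub_mul, add_mul, coeff_sub, coeff_add, coeff_C_mul, coeff_C_mul]
    rcases hk.eq_or_lt with h | h
    · rw [← h, coeff_X_mul_rootPoly, coeff_X_mul_rootPoly, coeff_rootPoly_self,
        coeff_rootPoly_self, sum_add_distrib]
      simp
      ring
    · rw [coeff_rootPoly_of_lt _ h, coeff_rootPoly_of_lt _ h]
      obtain ⟨k, rfl⟩ : ∃ l, k = l + 1 := ⟨k - 1, by omega⟩
      rw [coeff_X_mul, coeff_X_mul]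
      rcases (show n + 1 ≤ k by omega).eq_or_lt with h | h
      · rw [← h, coeff_rootPoly_self, coeff_rootPoly_self]; simp
      · rw [coeff_rootPoly_of_lt _ h, coeff_rootPoly_of_lt _ h]; simp
  have h := Lagrange.coeff_eq_sum hy hd
  have h1 := coeff_X_mul_rootPoly y (n + 1)
  have h1' := coeff_X_mul_rootPoly (fun k => y k + 1) (n + 1)
  have h2 := coeff_X_sq_mul_rootPoly y (n + 1)
  rw [coeff_X_mul] at h1 h1' h2
  rw [coeff_X_mul] at h2
  have h3 : g.coeff n = ∑ r ∈ range (n + 1), y r + (n + 1) * n / 2 := by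
    rw [hg, coeff_sub, sub_mul, add_mul, coeff_sub, coeff_add, coeff_C_mul, coeff_C_mul, h1, h1',
      h2, sum_add_distrib]
    simp
    ring
  rw [card_range, Nat.add_sub_cancel, h3] at h
  rw [h]
  refine sum_congr rfl fun r hr => ?_
  have h0 : ∏ k ∈ range (n + 1), (y r - y k) = 0 := prod_eq_zero hr (sub_self _)
  rw [hg, eval_sub, eval_mul, eval_mul, eval_rootPoly, eval_rootPoly, h0, mul_zero, zero_sub,
    ← mul_prod_erase _ _ hr, prod_div_distrib]
  have h4 : ∏ k ∈ (range (n + 1)).erase r, (y r - (y k + 1)) =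
      ∏ k ∈ (range (n + 1)).erase r, (y r - y k - 1) := prod_congr rfl fun k _ => by ring
  rw [h4]
  simp
  ring

end PartialFractions

section Growth

variable {α : ℝ}

theorem le_content_sub (hα : 0 < α) {f : ℕ → ℕ} (hf : Antitone f) {i k : ℕ} (h : i ≤ k) :
    (k : ℝ) - i ≤ content α f i - content α f k := by
  have : (f k : ℝ) ≤ f i := by exact_mod_cast hf h
  rw [content, content]
  nlinarith

theorem content_strictAnti (hα : 0 < α) {f : ℕ → ℕ} (hf : Antitone f) :
    StrictAnti (content α f) := fun i k h => by
  have := le_content_sub hα hf h.le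
  have : (i : ℝ) < k := by exact_mod_cast h
  linarith

theorem content_of_eq_zero {f : ℕ → ℕ} {i : ℕ} (h : f i = 0) : content α f i = -i := by
  simp [content, h]

theorem content_addBox_self (f : ℕ → ℕ) (r : ℕ) :
    content α (addBox f r) r = content α f r + α := by
  rw [content, content, addBox_self]
  push_cast
  ring

theorem content_addBox_of_ne (f : ℕ → ℕ) {r i : ℕ} (h : i ≠ r) :
    content α (addBox f r) i = content α f i := by
  rw [content, content, addBox_of_ne f h]

theorem growWeight_succ {x : ℕ → ℝ} (hx : StrictAnti x) {m : ℕ} (hm : x (m + 1) = x m - 1)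
    {i : ℕ} (hi : i ≤ m) : growWeight x (m + 1) i = growWeight x m i := by
  have h : (range (m + 1 + 1)).erase i = insert (m + 1) ((range (m + 1)).erase i) := by
    rw [range_add_one (n := m + 1), erase_insert_of_ne (by omega)]
  have h0 : x i - x (m + 1) ≠ 0 := (sub_pos.2 (hx (by omega))).ne'
  rw [growWeight, growWeight, h, prod_insert (by simp), prod_range_succ,
    show x i - x m + 1 = x i - x (m + 1) by rw [hm]; ring, mul_comm, mul_div_mul_left _ _ h0]

theorem growWeight_eq_zero {x : ℕ → ℝ} {m i j : ℕ} (hj : j < m) (h : x i = x j - 1) :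
    growWeight x m i = 0 := by
  rw [growWeight, prod_eq_zero (mem_range.2 hj) (by rw [h]; ring), zero_div]

theorem growMoment_succ {x : ℕ → ℝ} (hx : StrictAnti x) {m : ℕ} (hm : x (m + 1) = x m - 1)
    (k : ℕ) : growMoment x (m + 1) k = growMoment x m k := by
  rw [growMoment, sum_range_succ, growWeight_eq_zero m.lt_succ_self hm, zero_mul, add_zero,
    growMoment]
  refine sum_congr rfl fun i hi => ?_
  rw [growWeight_succ hx hm (by rw [mem_range] at hi; omega)]

theorem growMoment_recurrence {x y : ℕ → ℝ} {m r : ℕ} (hr : r < m) (hyr : y r = x r + α)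
    (hne : ∀ i, i ≠ r → y i = x i) (hx : Function.Injective x) (hy : Function.Injective y) (k : ℕ) :
    growMoment y m (k + 2) - growMoment x m (k + 2) =
      (2 * x r + (α - 1)) * (growMoment y m (k + 1) - growMoment x m (k + 1))
      - (x r ^ 2 + (α - 1) * x r) * (growMoment y m k - growMoment x m k)
      + α * growMoment y m k := by
  have h : ∀ j ∈ range (m + 1), growWeight y m j * ((y j - x r - α) * (y j - x r + 1)) =
      growWeight x m j * ((x j - x r) * (x j - x r - (α - 1))) := by
    intro j hj
    by_cases hjr : j = r
    · subst hjr; simp [hyr]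
    have h1 : r ∈ range m := mem_range.2 hr
    have h2 : r ∈ (range (m + 1)).erase j :=
      mem_erase.2 ⟨Ne.symm hjr, mem_range.2 (by omega)⟩
    have h3 : ∏ k ∈ (range m).erase r, (x j - y k + 1) = ∏ k ∈ (range m).erase r, (x j - x k + 1) :=
      prod_congr rfl fun k hk => by rw [hne k (ne_of_mem_erase hk)]
    have h4 : ∏ k ∈ ((range (m + 1)).erase j).erase r, (x j - y k) =
        ∏ k ∈ ((range (m + 1)).erase j).erase r, (x j - x k) :=
      prod_congr rfl fun k hk => by rw [hne k (ne_of_mem_erase hk)]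
    have h5 : ∏ k ∈ ((range (m + 1)).erase j).erase r, (x j - x k) ≠ 0 :=
      prod_ne_zero_iff.2 fun k hk =>
        sub_ne_zero.2 fun e => ne_of_mem_erase (mem_of_mem_erase hk) (hx e).symm
    have h6 : x j - x r ≠ 0 := sub_ne_zero.2 fun e => hjr (hx e)
    have h7 : x j - (x r + α) ≠ 0 := sub_ne_zero.2 fun e => hjr (hy (by rw [hne j hjr, hyr, e]))
    rw [growWeight, growWeight, ← mul_prod_erase _ _ h1, ← mul_prod_erase _ _ h2,
      ← mul_prod_erase (range m) _ h1, ← mul_prod_erase (erase _ _) _ h2, hne j hjr, hyr, h3, h4]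
    field_simp
    ring
  have hs : ∑ j ∈ range (m + 1), growWeight y m j * ((y j - x r - α) * (y j - x r + 1)) * y j ^ k =
      ∑ j ∈ range (m + 1), growWeight x m j * ((x j - x r) * (x j - x r - (α - 1))) * x j ^ k := by
    refine sum_congr rfl fun j hj => ?_
    rw [h j hj]
    by_cases hjr : j = r
    · subst hjr; simp
    · rw [hne j hjr]
  have e1 : ∑ j ∈ range (m + 1), growWeight y m j * ((y j - x r - α) * (y j - x r + 1)) * y j ^ k =
      growMoment y m (k + 2) - (2 * x r + (α - 1)) * growMoment y m (k + 1)
        + (x r ^ 2 + (α - 1) * x r - α) * growMoment y m k := by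
    simp only [growMoment, mul_sum, ← sum_sub_distrib, ← sum_add_distrib]
    exact sum_congr rfl fun j _ => by ring
  have e2 : ∑ j ∈ range (m + 1),
      growWeight x m j * ((x j - x r) * (x j - x r - (α - 1))) * x j ^ k =
      growMoment x m (k + 2) - (2 * x r + (α - 1)) * growMoment x m (k + 1)
        + (x r ^ 2 + (α - 1) * x r) * growMoment x m k := by
    simp only [growMoment, mul_sum, ← sum_sub_distrib, ← sum_add_distrib]
    exact sum_congr rfl fun j _ => by ring
  rw [e1, e2] at hs
  linear_combination hs

theorem range_erase_eq {r m : ℕ} (hr : r < m) :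
    (range m).erase r = (range r).disjUnion (Ico (r + 1) m)
      (disjoint_left.2 fun a => by simp; omega) := by
  ext a
  simp
  omega

/-- The backward transition weights. -/
noncomputable def shrinkWeight (y : ℕ → ℝ) (n r : ℕ) : ℝ :=
  (y r + n) * ∏ k ∈ (range (n + 1)).erase r, ((y r - y k - 1) / (y r - y k))

theorem growWeight_mul_hook_ratio (hα : 0 < α) {f : ℕ → ℕ} {n r : ℕ}
    (hf : Antitone f) (hn : f n = 0) (hr : r ≤ n) (hadd : ∀ i < r, f r < f i) :
    hookProd α 1 (n + 1) (addBox f r) * hookProd α α (n + 1) (addBox f r)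
      * growWeight (content α f) n r =
    hookProd α 1 (n + 1) f * hookProd α α (n + 1) f
      * shrinkWeight (content α (addBox f r)) n r := by
  have hn1 : f (n + 1) = 0 := Nat.eq_zero_of_le_zero (hn ▸ hf n.le_succ)
  have hrn : r < n + 1 := by omega
  have hx := content_strictAnti hα hf
  have hm : content α f (n + 1) = content α f n - 1 := by
    rw [content_of_eq_zero hn, content_of_eq_zero hn1]
    push_cast
    ring
  have hins : (range (n + 1 + 1)).erase r = insert (n + 1) ((range (n + 1)).erase r) := by
    rw [range_add_one (n := n + 1), erase_insert_of_ne (by omega)]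
  have hS : ∏ k ∈ (range (n + 1)).erase r,
      ((content α (addBox f r) r - content α (addBox f r) k - 1) /
        (content α (addBox f r) r - content α (addBox f r) k)) = 
      ∏ k ∈ (range (n + 1)).erase r, ((content α f r + α - content α f k - 1) /
        (content α f r + α - content α f k)) := prod_congr rfl fun k hk => by
    rw [content_addBox_self, content_addBox_of_ne f (ne_of_mem_erase hk)]
  rw [hookProd_addBox hα one_pos hf hrn hadd, hookProd_addBox hα hα hf hrn hadd,
    ← growWeight_succ hx hm hr, growWeight, hins, prod_insert (by simp),
    ← mul_prod_erase _ _ (mem_range.2 hrn), content_of_eq_zero hn1, shrinkWeight, hS,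
    content_addBox_self, range_erase_eq hrn]
  simp only [prod_disjUnion]
  have hA : ∀ i ∈ range r, (content α f r + α - content α f i - 1) /
      (content α f r + α - content α f i) =
      ((content α f i - content α f r - α + 1) / (content α f i - content α f r - α - 1 + 1)) *
      ((content α f i - content α f r - α + α) / (content α f i - content α f r - α - 1 + α)) *
      ((content α f r - content α f i + 1) / (content α f r - content α f i)) := by
    intro i hi
    rw [mem_range] at hi
    have h1 : (i : ℝ) + 1 ≤ r := by exact_mod_cast hi
    have h2 : (f r : ℝ) + 1 ≤ f i := by exact_mod_cast hadd i hi
    have h3 : α + (r - i) ≤ content α f i - content α f r := by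
      rw [content, content]; nlinarith
    have p1 : content α f i - content α f r - α - 1 + 1 ≠ 0 := by linarith
    have p2 : content α f i - content α f r - α - 1 + α ≠ 0 := by linarith
    have p3 : content α f r - content α f i ≠ 0 := by linarith
    have p4 : content α f r + α - content α f i ≠ 0 := by linarith
    field_simp
    ring
  have hB : ∀ k ∈ Ico (r + 1) (n + 1), (content α f r + α - content α f k - 1) /
      (content α f r + α - content α f k) =
      ((content α f r - content α f k - 1 + 1) / (content α f r - content α f k + 1)) *
      ((content α f r - content α f k - 1 + α) / (content α f r - content α f k + α)) *
      ((content α f r - content α f k + 1) / (content α f r - content α f k)) := by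
    intro k hk
    rw [mem_Ico] at hk
    have h1 := hx (show r < k by omega)
    have p1 : content α f r - content α f k + 1 ≠ 0 := by linarith
    have p2 : content α f r - content α f k + α ≠ 0 := by linarith
    have p3 : content α f r - content α f k ≠ 0 := by linarith
    have p4 : content α f r + α - content α f k ≠ 0 := by linarith
    field_simp
    ring
  rw [prod_congr rfl hA, prod_congr rfl hB]
  simp only [prod_mul_distrib]
  rw [prod_div_distrib (s := range r) (f := fun k => content α f r - content α f k + 1),
    prod_div_distrib (s := Ico (r + 1) (n + 1))
      (f := fun k => content α f r - content α f k + 1)]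
  have h5 : content α f r + (n + 1) ≠ 0 := by
    have h1 := hx hrn
    rw [content_of_eq_zero hn1] at h1
    push_cast at h1
    linarith
  generalize (∏ k ∈ range r, (content α f r - content α f k)) = a1
  generalize (∏ k ∈ range r, (content α f r - content α f k + 1)) = a2
  generalize (∏ k ∈ Ico (r + 1) (n + 1), (content α f r - content α f k)) = b1
  generalize (∏ k ∈ Ico (r + 1) (n + 1), (content α f r - content α f k + 1)) = b2
  generalize (∏ k ∈ range r, (_ : ℝ) / (_ : ℝ)) = a3
  generalize (∏ k ∈ range r, (_ : ℝ) / (_ : ℝ)) = a4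
  generalize (∏ k ∈ Ico (r + 1) (n + 1), (_ : ℝ) / (_ : ℝ)) = b3
  generalize (∏ k ∈ Ico (r + 1) (n + 1), (_ : ℝ) / (_ : ℝ)) = b4
  generalize hookProd α 1 (n + 1) f = u
  generalize hookProd α α (n + 1) f = v
  push_cast
  generalize content α f r = z at *
  rw [sub_neg_eq_add, sub_self]
  have h6 : (z + (n + 1)) * (z + (n + 1))⁻¹ = 1 := mul_inv_cancel₀ h5
  simp only [div_eq_mul_inv, mul_inv]
  linear_combination (u * v * b3 * a3 * b4 * a4 * a2 * b2 * a1⁻¹ * b1⁻¹ * (z + n + α)) * h6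

end Growth

section UpDown

variable {α : ℝ} {n r : ℕ} {f : ℕ → ℕ}

theorem IsShape.succ_eq_zero (hf : IsShape n f) : f (n + 1) = 0 :=
  Nat.eq_zero_of_le_zero (hf.2.2 ▸ hf.1 n.le_succ)

theorem isShape_of_sum (hf : Antitone f) (hs : ∑ i ∈ range (n + 1), f i = n) : IsShape n f := by
  have h0 : f n = 0 := by
    by_contra h
    have h1 := card_nsmul_le_sum (range (n + 1)) f 1 fun i hi =>
      (Nat.one_le_iff_ne_zero.2 h).trans (hf (by rw [mem_range] at hi; omega))
    rw [hs] at h1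
    simp at h1
  exact ⟨hf, by rwa [sum_range_succ, h0, add_zero] at hs, h0⟩

theorem isShape_addBox (hf : IsShape n f) (hr : r ≤ n) (hadd : ∀ i < r, f r < f i) :
    IsShape (n + 1) (addBox f r) := by
  refine ⟨fun i j hij => ?_, ?_, ?_⟩
  · have h := hf.1 hij
    by_cases hj : j = r
    · subst hj
      by_cases hi : i = j
      · rw [hi]
      · rw [addBox_self, addBox_of_ne f hi]
        exact hadd i (by omega)
    · rw [addBox_of_ne f hj]
      by_cases hi : i = r
      · subst hi
        rw [addBox_self]
        omega
      · rwa [addBox_of_ne f hi]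
  · rw [addBox, sum_update_of_mem (mem_range.2 (by omega)), sdiff_singleton_eq_erase]
    have h := add_sum_erase (range (n + 1)) f (mem_range.2 (show r < n + 1 by omega))
    rw [sum_range_succ, hf.2.1, hf.2.2] at h
    omega
  · rw [addBox_of_ne f (by omega), hf.succ_eq_zero]

theorem growWeight_eq_zero_of_not_addable (hf : Antitone f) (hr : r ≤ n)
    (h : ¬ ∀ i < r, f r < f i) : growWeight (content α f) n r = 0 := by
  push Not at h
  obtain ⟨i, hi, h⟩ := h
  have h1 : f (r - 1) = f r :=
    le_antisymm ((hf (show i ≤ r - 1 by omega)).trans h) (hf (Nat.sub_le _ _))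
  refine growWeight_eq_zero (j := r - 1) (by omega) ?_
  rw [content, content, h1, Nat.cast_sub (by omega)]
  push_cast
  ring

theorem shrinkWeight_eq_zero_of_not_removable (hf : IsShape (n + 1) f) (hr : r ≤ n)
    (h : f r ≤ f (r + 1)) : shrinkWeight (content α f) n r = 0 := by
  have h1 : f (r + 1) = f r := le_antisymm (hf.1 r.le_succ) h
  rcases hr.eq_or_lt with rfl | hr
  · rw [hf.2.2] at h1
    rw [shrinkWeight, content_of_eq_zero h1.symm, neg_add_cancel, zero_mul]
  · rw [shrinkWeight, prod_eq_zero (i := r + 1) (mem_erase.2 ⟨by omega, mem_range.2 (by omega)⟩),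
      mul_zero]
    rw [content, content, h1]
    push_cast
    rw [show α * f r - r - (α * f r - (r + 1)) - 1 = 0 by ring, zero_div]

theorem exists_addBox_eq (hf : IsShape (n + 1) f) (hr : r ≤ n) (h : f (r + 1) < f r) :
    ∃ g, IsShape n g ∧ (∀ i < r, g r < g i) ∧ addBox g r = f := by
  refine ⟨Function.update f r (f r - 1), isShape_of_sum (fun i j hij => ?_) ?_, fun i hi => ?_, ?_⟩
  · have h1 := hf.1 hij
    by_cases hj : j = r
    · subst hj
      by_cases hi : i = j
      · rw [hi]
      · simp only [Function.update_self, Function.update_of_ne hi]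
        omega
    · by_cases hi : i = r
      · subst hi
        have := hf.1 (show i + 1 ≤ j by omega)
        simp only [Function.update_self, Function.update_of_ne hj]
        omega
      · simpa only [Function.update_of_ne hi, Function.update_of_ne hj] using h1
  · rw [sum_update_of_mem (mem_range.2 (by omega)), sdiff_singleton_eq_erase]
    have h1 := add_sum_erase (range (n + 1)) f (mem_range.2 (show r < n + 1 by omega))
    rw [hf.2.1] at h1
    omega
  · have := hf.1 hi.le
    simp only [Function.update_self, Function.update_of_ne hi.ne]
    omega
  · rw [addBox, Function.update_self, Function.update_idem, Nat.sub_add_cancel (by omega),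
      Function.update_eq_self]

theorem addBox_injective : Function.Injective fun f : ℕ → ℕ => addBox f r := by
  intro f g h
  ext i
  have h1 := congrFun h i
  by_cases hi : i = r
  · subst hi
    simpa [addBox_self] using h1
  · simpa [addBox_of_ne _ hi] using h1

theorem sum_shrinkWeight_content (hα : 0 < α) (hf : IsShape (n + 1) f) :
    ∑ r ∈ range (n + 1), shrinkWeight (content α f) n r = α * (n + 1) := by
  have h1 : ∑ r ∈ range (n + 1), (r : ℝ) = (n + 1) * n / 2 := by
    rw [← Nat.cast_sum, sum_range_id, ← Nat.choose_two_right, Nat.cast_choose_two]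
    push_cast
    ring
  have h2 : ∑ r ∈ range (n + 1), (f r : ℝ) = n + 1 := by exact_mod_cast hf.2.1
  have h3 := sum_shrinkWeight (n := n) ((content_strictAnti hα hf.1).injective.injOn)
  simp only [← shrinkWeight.eq_def] at h3
  rw [h3]
  simp only [content, sum_sub_distrib, ← mul_sum, h1, h2]
  ring

/-- The Jack measure, as a function of the shape. -/
noncomputable def jackWeight (α : ℝ) (n : ℕ) (f : ℕ → ℕ) : ℝ :=
  α ^ n * n.factorial / (hookProd α 1 (n + 1) f * hookProd α α (n + 1) f)

theorem jackP_eq_jackWeight (hα : 0 < α) (lam : n.Partition) :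
    jackP α lam = jackWeight α n (rowLen lam) := jackP_eq lam hα n.le_succ

theorem jackWeight_succ (hα : 0 < α) (hf : IsShape (n + 1) f) : jackWeight α (n + 1) f =
    α ^ (n + 1) * (n + 1).factorial / (hookProd α 1 (n + 1) f * hookProd α α (n + 1) f) := by
  obtain ⟨lam, rfl⟩ := exists_rowLen_eq hf
  rw [← jackP_eq_jackWeight hα, jackP_eq lam hα le_rfl]

theorem jackWeight_mul_growWeight (hα : 0 < α) (hf : IsShape n f) (hr : r ≤ n)
    (hadd : ∀ i < r, f r < f i) : jackWeight α n f * growWeight (content α f) n r =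
    jackWeight α (n + 1) (addBox f r) * shrinkWeight (content α (addBox f r)) n r
      / (α * (n + 1)) := by
  have h := growWeight_mul_hook_ratio hα hf.1 hf.2.2 hr hadd
  have p1 := (hookProd_pos hα one_pos (n + 1) f).ne'
  have p2 := (hookProd_pos hα hα (n + 1) f).ne'
  have p3 := (hookProd_pos hα one_pos (n + 1) (addBox f r)).ne'
  have p4 := (hookProd_pos hα hα (n + 1) (addBox f r)).ne'
  rw [jackWeight_succ hα (isShape_addBox hf hr hadd), jackWeight, Nat.factorial_succ]
  push_cast
  have p5 : (n : ℝ) + 1 ≠ 0 := by positivity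
  have p6 := hα.ne'
  field_simp
  linear_combination α ^ (n + 1) * h

theorem sum_jackWeight_succ (hα : 0 < α) (φ : (ℕ → ℕ) → ℝ) :
    ∑ f ∈ shapes n, jackWeight α n f *
      ∑ r ∈ range (n + 1), growWeight (content α f) n r * φ (addBox f r) =
    ∑ f ∈ shapes (n + 1), jackWeight α (n + 1) f * φ f := by
  have p5 : α * ((n : ℝ) + 1) ≠ 0 := by positivity
  have h1 : ∀ f ∈ shapes (n + 1), jackWeight α (n + 1) f * φ f =
      ∑ r ∈ range (n + 1),
        jackWeight α (n + 1) f * shrinkWeight (content α f) n r / (α * (n + 1)) * φ f := by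
    intro f hf
    rw [← sum_mul, ← sum_div, ← mul_sum, sum_shrinkWeight_content hα (mem_shapes.1 hf),
      mul_div_cancel_right₀ _ p5]
  have h2 : ∀ f : ℕ → ℕ, ∀ r ≤ n, IsShape n f → (∀ i < r, f r < f i) →
      jackWeight α n f * growWeight (content α f) n r * φ (addBox f r) =
      jackWeight α (n + 1) (addBox f r) * shrinkWeight (content α (addBox f r)) n r
        / (α * (n + 1)) * φ (addBox f r) := fun f r hr hf hadd => by
    rw [jackWeight_mul_growWeight hα hf hr hadd]
  rw [sum_congr rfl h1]
  simp only [mul_sum, ← mul_assoc]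
  rw [← sum_product', ← sum_product']
  have hadd : ∀ q ∈ shapes n ×ˢ range (n + 1), jackWeight α n q.1 *
      growWeight (content α q.1) n q.2 * φ (addBox q.1 q.2) ≠ 0 →
      IsShape n q.1 ∧ q.2 ≤ n ∧ ∀ i < q.2, q.1 q.2 < q.1 i := by
    intro q hq h
    rw [mem_product, mem_shapes, mem_range, Nat.lt_succ_iff] at hq
    refine ⟨hq.1, hq.2, ?_⟩
    by_contra h3
    rw [growWeight_eq_zero_of_not_addable hq.1.1 hq.2 h3] at h
    simp at h
  refine sum_bij_ne_zero (fun q _ _ => (addBox q.1 q.2, q.2)) ?_ ?_ ?_ ?_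
  · intro q hq h
    obtain ⟨h1, h2, h3⟩ := hadd q hq h
    rw [mem_product, mem_shapes, mem_range]
    exact ⟨isShape_addBox h1 h2 h3, by simpa [Nat.lt_succ_iff] using h2⟩
  · rintro ⟨f, r⟩ _ _ ⟨g, s⟩ _ _ h
    simp only [Prod.mk.injEq] at h
    obtain ⟨h, rfl⟩ := h
    rw [addBox_injective h]
  · rintro ⟨F, r⟩ hF h
    rw [mem_product, mem_shapes, mem_range, Nat.lt_succ_iff] at hF
    obtain ⟨hF, hr⟩ := hF
    dsimp only at hF hr h
    have h3 : F (r + 1) < F r := by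
      by_contra h3
      rw [shrinkWeight_eq_zero_of_not_removable hF hr (by omega)] at h
      simp at h
    obtain ⟨f, hf, hadd, rfl⟩ := exists_addBox_eq hF hr h3
    refine ⟨(f, r), ?_, ?_, rfl⟩
    · rw [mem_product, mem_shapes, mem_range]
      exact ⟨hf, Nat.lt_succ_iff.2 hr⟩
    · rwa [h2 f r hr hf hadd]
  · intro q hq h
    obtain ⟨h3, h4, h5⟩ := hadd q hq h
    exact h2 q.1 q.2 h4 h3 h5

end UpDown

section Spectral

variable {α : ℝ}

/-- A shape of size `q.1.1` and a row in which a box can be added to it. -/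
def Growth : Type :=
  {q : (ℕ × (ℕ → ℕ)) × ℕ // IsShape q.1.1 q.1.2 ∧ q.2 ≤ q.1.1 ∧ ∀ i < q.2, q.1.2 q.2 < q.1.2 i}

/-- The shape before the growth. -/
def Growth.source (q : Growth) : ℕ × (ℕ → ℕ) := q.1.1

/-- The shape after the growth. -/
def Growth.target (q : Growth) : ℕ × (ℕ → ℕ) := (q.1.1.1 + 1, addBox q.1.1.2 q.1.2)

/-- The content of the added box. -/
def Growth.boxContent (α : ℝ) (q : Growth) : ℝ := content α q.1.1.2 q.1.2

/-- The sum of the contents of a shape. -/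
def energy (α : ℝ) (p : ℕ × (ℕ → ℕ)) : ℝ :=
  ∑ i ∈ range p.1, (α * ((p.2 i).choose 2) - i * p.2 i)

/-- The moments of the growth weights of a shape. -/
noncomputable def shapeMoment (α : ℝ) (k : ℕ) (p : ℕ × (ℕ → ℕ)) : ℝ :=
  growMoment (content α p.2) p.1 k

/-- The expectation under the Jack measure. -/
noncomputable def jackMean (α : ℝ) (n : ℕ) : (ℕ × (ℕ → ℕ) → ℝ) →ₗ[ℝ] ℝ :=
  ∑ f ∈ shapes n, jackWeight α n f • LinearMap.proj (n, f)

/-- The expectation under the growth process. -/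
noncomputable def growthMean (α : ℝ) (n : ℕ) : (Growth → ℝ) →ₗ[ℝ] ℝ :=
  (∑ f ∈ shapes n, jackWeight α n f • ∑ r ∈ range (n + 1),
    growWeight (content α f) n r • LinearMap.proj ((n, f), r)) ∘ₗ
  Function.ExtendByZero.linearMap ℝ (fun q : Growth => q.1)

theorem jackMean_apply (n : ℕ) (φ : ℕ × (ℕ → ℕ) → ℝ) :
    jackMean α n φ = ∑ f ∈ shapes n, jackWeight α n f * φ (n, f) := by
  simp [jackMean]

theorem growthMean_comp (n : ℕ) (ψ : (ℕ × (ℕ → ℕ)) × ℕ → ℝ) :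
    growthMean α n (fun q => ψ q.1) = ∑ f ∈ shapes n, jackWeight α n f *
      ∑ r ∈ range (n + 1), growWeight (content α f) n r * ψ ((n, f), r) := by
  simp only [growthMean, LinearMap.comp_apply, LinearMap.sum_apply, LinearMap.smul_apply,
    LinearMap.proj_apply, smul_eq_mul, Function.ExtendByZero.linearMap_apply]
  refine sum_congr rfl fun f hf => ?_
  rw [mem_shapes] at hf
  congr 1
  refine sum_congr rfl fun r hr => ?_
  rw [mem_range, Nat.lt_succ_iff] at hr
  by_cases h : ∀ i < r, f r < f i
  · congr 1
    exact Function.Injective.extend_apply (g := fun q : Growth => ψ q.1)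
      Subtype.val_injective 0 ⟨((n, f), r), hf, hr, h⟩
  · rw [growWeight_eq_zero_of_not_addable hf.1 hr h, zero_mul, zero_mul]

theorem jackMean_succ (hα : 0 < α) (n : ℕ) (φ : ℕ × (ℕ → ℕ) → ℝ) :
    jackMean α (n + 1) φ = growthMean α n (fun q => φ q.target) := by
  rw [jackMean_apply, ← sum_jackWeight_succ hα fun f => φ (n + 1, f)]
  exact (growthMean_comp n fun q => φ (q.1.1 + 1, addBox q.1.2 q.2)).symm

theorem growthMean_source (n j : ℕ) (φ : ℕ × (ℕ → ℕ) → ℝ) :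
    growthMean α n (fun q => q.boxContent α ^ j * φ q.source) =
      jackMean α n (fun p => shapeMoment α j p * φ p) := by
  refine (growthMean_comp n fun q => content α q.1.2 q.2 ^ j * φ q.1).trans ?_
  rw [jackMean_apply]
  refine sum_congr rfl fun f _ => ?_
  rw [shapeMoment, growMoment, sum_mul]
  congr 1
  exact sum_congr rfl fun r _ => (mul_assoc _ _ _).symm

theorem energy_target (q : Growth) : energy α q.target = energy α q.source + q.boxContent α := by
  obtain ⟨⟨⟨n, f⟩, r⟩, hf, hr, hadd⟩ := q
  dsimp only at hf hr hadd
  have h : energy α (n, f) = ∑ i ∈ range (n + 1), (α * ((f i).choose 2) - i * f i) := by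
    rw [sum_range_succ, hf.2.2]
    simp [energy]
  have hmem : r ∈ range (n + 1) := mem_range.2 (Nat.lt_succ_iff.2 hr)
  simp only [Growth.target, Growth.source, Growth.boxContent]
  rw [h, energy]
  dsimp only
  rw [← add_sum_erase _ _ hmem, ← add_sum_erase (range (n + 1)) _ hmem,
    sum_congr rfl fun i hi => by rw [addBox_of_ne f (ne_of_mem_erase hi)], addBox_self,
    Nat.choose_succ_succ, Nat.choose_one_right, content]
  push_cast
  ring

theorem shapeMoment_zero (hα : 0 < α) {n : ℕ} {f : ℕ → ℕ} (hf : IsShape n f) :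
    shapeMoment α 0 (n, f) = 1 :=
  growMoment_zero (content_strictAnti hα hf.1).injective.injOn

theorem shapeMoment_one (hα : 0 < α) {n : ℕ} {f : ℕ → ℕ} (hf : IsShape n f) :
    shapeMoment α 1 (n, f) = 0 :=
  growMoment_one (content_strictAnti hα hf.1).injective.injOn (content_of_eq_zero hf.2.2)

theorem Growth.isShape_source (q : Growth) : IsShape q.source.1 q.source.2 := q.2.1

theorem Growth.isShape_target (q : Growth) : IsShape q.target.1 q.target.2 :=
  isShape_addBox q.2.1 q.2.2.1 q.2.2.2

theorem shapeMoment_recurrence (hα : 0 < α) (k : ℕ) (q : Growth) (C : ℕ → ℝ)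
    (hC : ∀ k, C k = shapeMoment α k q.target - shapeMoment α k q.source) :
    C (k + 2) = (2 * q.boxContent α + (α - 1)) * C (k + 1)
      - (q.boxContent α ^ 2 + (α - 1) * q.boxContent α) * C k
      + α * shapeMoment α k q.target := by
  have h : ∀ j, shapeMoment α j q.source = growMoment (content α q.source.2) (q.source.1 + 1) j :=
    fun j => by
      refine (growMoment_succ (content_strictAnti hα q.isShape_source.1) ?_ j).symm
      rw [content_of_eq_zero q.isShape_source.2.2, content_of_eq_zero q.isShape_source.succ_eq_zero]
      push_cast
      ring
  simp only [hC, h]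
  exact growMoment_recurrence (Nat.lt_succ_iff.2 q.2.2.1) (content_addBox_self _ _)
    (fun i hi => content_addBox_of_ne _ hi) (content_strictAnti hα q.isShape_source.1).injective
    (content_strictAnti hα q.isShape_target.1).injective k

/-- The linear form on operators given by the vacuum and the evaluation at one. -/
noncomputable def vacuumForm : Module.End ℝ Fock →ₗ[ℝ] ℝ :=
  evalOne.toLinearMap ∘ₗ LinearMap.applyₗ (1 : Fock)

theorem vacuumForm_apply (b : Module.End ℝ Fock) : vacuumForm b = evalOne (b 1) := rfl

theorem isShape_zero : IsShape 0 0 := ⟨fun _ _ _ => le_rfl, rfl, rfl⟩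

theorem apply_one_of_mem_wordPairs {w : Module.End ℝ Fock × (ℕ × (ℕ → ℕ) → ℝ)}
    (hw : w ∈ wordPairs (ham α (α - 1)) (integral α (α - 1)) (energy α) (shapeMoment α)) :
    w.1 1 = w.2 (0, 0) • (1 : Fock) := by
  induction hw using Algebra.adjoin_induction with
  | mem x hx =>
    obtain rfl | ⟨k, rfl⟩ := hx
    · simp [ham_apply_one, energy]
    · simp [integral_apply_one, shapeMoment, growMoment, growWeight, content]
  | algebraMap r => simp [Algebra.algebraMap_eq_smul_one]
  | add x y _ _ hx hy => simp [hx, hy, add_smul]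
  | mul x y _ _ hx hy => simp [hx, hy, smul_smul, mul_comm]

theorem jackMean_zero (φ : ℕ × (ℕ → ℕ) → ℝ) : jackMean α 0 φ = φ (0, 0) := by
  have h : shapes 0 = {0} := by
    ext f
    rw [mem_shapes, mem_singleton]
    refine ⟨fun hf => funext fun i => ?_, fun h => h ▸ isShape_zero⟩
    exact Nat.eq_zero_of_le_zero (hf.2.2 ▸ hf.1 i.zero_le)
  rw [jackMean_apply, h, sum_singleton]
  simp [jackWeight, hookProd, rowHook, hookRun]

theorem evalOne_ham_pow (hα : 0 < α) (n r : ℕ) :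
    evalOne ((ham α (α - 1) ^ r) (MvPolynomial.X 0 ^ n)) =
      ∑ lam : n.Partition, jackP α lam * (α * nStatConj lam - nStat lam) ^ r := by
  have hX : (LinearMap.mulLeft ℝ (MvPolynomial.X 0 : Fock)) ^ n =
      LinearMap.mulLeft ℝ ((MvPolynomial.X 0 : Fock) ^ n) := LinearMap.pow_mulLeft ℝ Fock _ n
  have hcomm := integral_comm_creation_mem (D := ham α (α - 1)) (I := integral α (α - 1))
    (E := creation α (α - 1)) (e := energy α) (M := shapeMoment α) (src := Growth.source)
    (tgt := Growth.target) (c := Growth.boxContent α) (α := α) (β := α - 1)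
    (creation_zero α (α - 1)) (creation_succ α (α - 1))
    (fun q => by rw [shapeMoment_zero hα q.isShape_source, shapeMoment_zero hα q.isShape_target])
    (fun q => by rw [shapeMoment_one hα q.isShape_source, shapeMoment_one hα q.isShape_target])
    (by rw [integral_zero, one_mul, mul_one]) (by rw [integral_one, zero_mul, mul_zero])
    (integral_recurrence α (α - 1)) (shapeMoment_recurrence hα)
  have h := functional_word_mul_pow
    (word_mul_creation_mem (creation_zero α (α - 1)) (creation_succ α (α - 1))
      (ham_comm_integral α (α - 1)) energy_target hcomm)
    vacuumForm (fun j w => evalOne_forget _) (jackMean α) (growthMean α)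
    (jackMean_succ hα) growthMean_source
    (fun w hw => by
      rw [vacuumForm_apply, apply_one_of_mem_wordPairs hw, jackMean_zero, map_smul, map_one,
        smul_eq_mul, mul_one]) n _ (pow_mem hamiltonian_mem r)
  rw [hX, vacuumForm_apply, jackMean_apply] at h
  simp only [Prod.pow_fst, Module.End.mul_apply, LinearMap.mulLeft_apply, mul_one] at h
  rw [h, shapes, sum_map]
  refine sum_congr rfl fun lam _ => ?_
  rw [jackP_eq_jackWeight hα, sub_nStat_eq]
  rfl

end Spectral

section Cycles

open Equiv Equiv.Perm

theorem sameCycle_induction {V : Type*} [Finite V] {x : Perm V} {a b : V} {p : V → Prop} (ha : p a)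
    (h : ∀ u, p u → p (x u)) (hab : SameCycle x a b) : p b := by
  obtain ⟨i, rfl⟩ := hab.exists_nat_pow_eq
  clear hab
  induction i with
  | zero => exact ha
  | succ i ih => rw [pow_succ', mul_apply]; exact h _ ih

theorem mul_swap_mul_swap {V : Type*} [DecidableEq V] (x : Perm V) (a b : V) :
    x * swap a b * swap a b = x := by
  rw [mul_assoc, swap_mul_self, mul_one]

variable {V : Type*} [Fintype V] [DecidableEq V]

/-- The set of points of the cycle of `x` through `a`. -/
def cycleSet (x : Perm V) (a : V) : Finset V := univ.filter (SameCycle x a)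

/-- The set partition given by the cycles of `x`, fixed points included. -/
def cycleSets (x : Perm V) : Finset (Finset V) := univ.image (cycleSet x)

variable {x : Perm V} {a b u v : V}

theorem mem_cycleSet : b ∈ cycleSet x a ↔ SameCycle x a b := by simp [cycleSet]

theorem cycleSet_eq (h : SameCycle x a b) : cycleSet x a = cycleSet x b := by
  ext u
  rw [mem_cycleSet, mem_cycleSet]
  exact ⟨h.symm.trans, h.trans⟩

theorem cycleSet_eq_iff : cycleSet x a = cycleSet x b ↔ SameCycle x a b :=
  ⟨fun h => by rw [← mem_cycleSet, h, mem_cycleSet], cycleSet_eq⟩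

theorem cycleSet_mem (x : Perm V) (a : V) : cycleSet x a ∈ cycleSets x :=
  mem_image_of_mem _ (mem_univ a)

theorem eq_cycleSet_of_mem {s : Finset V} (hs : s ∈ cycleSets x) (ha : a ∈ s) :
    s = cycleSet x a := by
  obtain ⟨b, -, rfl⟩ := mem_image.1 hs
  exact cycleSet_eq (mem_cycleSet.1 ha)

theorem cycleSet_isCycleOn (x : Perm V) (a : V) : x.IsCycleOn (cycleSet x a : Set V) := by
  refine ⟨⟨fun u hu => ?_, x.injective.injOn, fun u hu => ⟨x⁻¹ u, ?_, by simp⟩⟩,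
    fun u hu v hv => ?_⟩
  · rw [mem_coe, mem_cycleSet] at hu ⊢
    exact sameCycle_apply_right.2 hu
  · rw [mem_coe, mem_cycleSet] at hu ⊢
    rw [← sameCycle_apply_right]
    simpa using hu
  · rw [mem_coe, mem_cycleSet] at hu hv
    exact hu.symm.trans hv

theorem sameCycle_mul_swap_pow {d : ℕ} (hd : ∀ i, 0 < i → i < d → (x ^ i) a ≠ a ∧ (x ^ i) a ≠ b)
    {i : ℕ} (hi : 0 < i) (hid : i ≤ d) : SameCycle (x * swap a b) b ((x ^ i) a) := by
  induction i with
  | zero => omega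
  | succ i ih =>
    obtain rfl | hi0 := Nat.eq_zero_or_pos i
    · refine ⟨1, ?_⟩
      simp
    · obtain ⟨h1, h2⟩ := hd i hi0 (by omega)
      refine (ih hi0 (by omega)).trans ⟨1, ?_⟩
      rw [zpow_one, mul_apply, swap_apply_of_ne_of_ne h1 h2, pow_succ', mul_apply]

theorem cycleSet_card_pos (x : Perm V) (a : V) : 0 < #(cycleSet x a) :=
  card_pos.2 ⟨a, mem_cycleSet.2 (SameCycle.refl _ _)⟩

theorem mem_cycleSet_self (x : Perm V) (a : V) : a ∈ cycleSet x a :=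
  mem_cycleSet.2 (SameCycle.refl _ _)

theorem pow_apply_ne_self {i : ℕ} (hi : 0 < i) (hic : i < #(cycleSet x a)) : (x ^ i) a ≠ a :=
  fun h => Nat.not_dvd_of_pos_of_lt hi hic
    (((cycleSet_isCycleOn x a).pow_apply_eq (mem_cycleSet_self x a)).1 h)

theorem pow_card_cycleSet (x : Perm V) (a : V) : (x ^ #(cycleSet x a)) a = a :=
  (cycleSet_isCycleOn x a).pow_card_apply (mem_cycleSet_self x a)

theorem pow_injOn (x : Perm V) (a : V) :
    Set.InjOn (fun i => (x ^ i) a) (range #(cycleSet x a)) := by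
  intro i hi j hj h
  have h1 := ((cycleSet_isCycleOn x a).pow_apply_eq_pow_apply (mem_cycleSet_self x a)).1 h
  rw [coe_range, Set.mem_Iio] at hi hj
  rwa [Nat.ModEq, Nat.mod_eq_of_lt hi, Nat.mod_eq_of_lt hj] at h1

theorem image_pow_range (x : Perm V) (a : V) :
    (range #(cycleSet x a)).image (fun i => (x ^ i) a) = cycleSet x a := by
  ext u
  rw [mem_image]
  constructor
  · rintro ⟨i, -, rfl⟩
    rw [mem_cycleSet]
    exact ⟨i, by simp⟩
  · intro hu
    obtain ⟨i, hi, h⟩ := (cycleSet_isCycleOn x a).exists_pow_eq (mem_cycleSet_self x a) hu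
    exact ⟨i, mem_range.2 hi, h⟩

theorem sameCycle_mul_swap (h : ¬ SameCycle x a b) : SameCycle (x * swap a b) a b := by
  have h1 := sameCycle_mul_swap_pow (x := x) (a := a) (b := b) (d := #(cycleSet x a))
    (fun i hi hic => ⟨pow_apply_ne_self hi hic, fun e => h ⟨i, by simpa using e⟩⟩)
    (cycleSet_card_pos x a) le_rfl
  rw [pow_card_cycleSet] at h1
  exact h1.symm

theorem SameCycle.mul_swap (h : ¬ SameCycle x a b) (huv : SameCycle x u v) :
    SameCycle (x * swap a b) u v := by
  have hab := sameCycle_mul_swap h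
  refine sameCycle_induction (p := SameCycle (x * swap a b) u) (SameCycle.refl _ _)
    (fun w hw => hw.trans ?_) huv
  by_cases h1 : w = a
  · subst h1
    exact hab.trans ⟨1, by simp⟩
  by_cases h2 : w = b
  · subst h2
    exact hab.symm.trans ⟨1, by simp⟩
  · exact ⟨1, by rw [zpow_one, mul_apply, swap_apply_of_ne_of_ne h1 h2]⟩

theorem cycleSet_mul_swap_left (h : ¬ SameCycle x a b) :
    cycleSet (x * swap a b) a = cycleSet x a ∪ cycleSet x b := by
  ext u
  rw [mem_union, mem_cycleSet, mem_cycleSet, mem_cycleSet]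
  constructor
  · refine sameCycle_induction (p := fun u => SameCycle x a u ∨ SameCycle x b u)
      (Or.inl (SameCycle.refl _ _)) fun w hw => ?_
    rw [mul_apply, sameCycle_apply_right, sameCycle_apply_right]
    by_cases h1 : w = a
    · subst h1
      simp [SameCycle.refl]
    by_cases h2 : w = b
    · subst h2
      simp [SameCycle.refl]
    · rwa [swap_apply_of_ne_of_ne h1 h2]
  · rintro (h1 | h1)
    · exact SameCycle.mul_swap h h1
    · exact (sameCycle_mul_swap h).trans (SameCycle.mul_swap h h1)

theorem cycleSet_mul_swap_of_not (h : ¬ SameCycle x a b) (ha : ¬ SameCycle x a u)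
    (hb : ¬ SameCycle x b u) : cycleSet (x * swap a b) u = cycleSet x u := by
  ext v
  rw [mem_cycleSet, mem_cycleSet]
  refine ⟨?_, SameCycle.mul_swap h⟩
  refine sameCycle_induction (p := SameCycle x u) (SameCycle.refl _ _) fun w hw => ?_
  rw [mul_apply, sameCycle_apply_right, swap_apply_of_ne_of_ne]
  · exact hw
  · rintro rfl
    exact ha hw.symm
  · rintro rfl
    exact hb hw.symm

theorem cycleSets_mul_swap (h : ¬ SameCycle x a b) : cycleSets (x * swap a b) =
    insert (cycleSet x a ∪ cycleSet x b)
      (((cycleSets x).erase (cycleSet x a)).erase (cycleSet x b)) := by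
  ext s
  rw [mem_insert, mem_erase, mem_erase]
  constructor
  · intro hs
    obtain ⟨u, -, rfl⟩ := mem_image.1 hs
    by_cases ha : SameCycle x a u
    · left
      rw [← cycleSet_mul_swap_left h]
      exact (cycleSet_eq (SameCycle.mul_swap h ha)).symm
    by_cases hb : SameCycle x b u
    · left
      rw [← cycleSet_mul_swap_left h]
      exact (cycleSet_eq ((sameCycle_mul_swap h).trans (SameCycle.mul_swap h hb))).symm
    · right
      rw [cycleSet_mul_swap_of_not h ha hb]
      exact ⟨fun e => hb (cycleSet_eq_iff.1 e).symm, fun e => ha (cycleSet_eq_iff.1 e).symm,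
        cycleSet_mem x u⟩
  · rintro (rfl | ⟨hb, ha, hs⟩)
    · rw [← cycleSet_mul_swap_left h]
      exact cycleSet_mem _ _
    · obtain ⟨u, -, rfl⟩ := mem_image.1 hs
      rw [← cycleSet_mul_swap_of_not h (fun e => ha (cycleSet_eq e).symm)
        fun e => hb (cycleSet_eq e).symm]
      exact cycleSet_mem _ _

theorem union_notMem_cycleSets :
    cycleSet x a ∪ cycleSet x b ∉ ((cycleSets x).erase (cycleSet x a)).erase (cycleSet x b) := by
  intro h
  rw [mem_erase, mem_erase] at h
  exact h.2.1 (eq_cycleSet_of_mem h.2.2 (mem_union_left _ (mem_cycleSet_self x a)))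

theorem card_cycleSet_union (h : ¬ SameCycle x a b) :
    #(cycleSet x a ∪ cycleSet x b) = #(cycleSet x a) + #(cycleSet x b) := by
  refine card_union_of_disjoint (disjoint_left.2 fun u ha hb => h ?_)
  rw [mem_cycleSet] at ha hb
  exact ha.trans hb.symm

theorem cycleSet_mem_erase (h : ¬ SameCycle x a b) :
    cycleSet x b ∈ (cycleSets x).erase (cycleSet x a) :=
  mem_erase.2 ⟨fun e => h (cycleSet_eq_iff.1 e).symm, cycleSet_mem x b⟩

theorem card_cycleSets_mul_swap (h : ¬ SameCycle x a b) :
    #(cycleSets (x * swap a b)) + 1 = #(cycleSets x) := by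
  rw [cycleSets_mul_swap h, card_insert_of_notMem union_notMem_cycleSets,
    card_erase_of_mem (cycleSet_mem_erase h), card_erase_of_mem (cycleSet_mem x a)]
  have h1 := card_pos.2 ⟨_, cycleSet_mem_erase h⟩
  rw [card_erase_of_mem (cycleSet_mem x a)] at h1
  omega

variable {R : Type*} [CommMonoid R]

theorem prod_cycleSets_merge (h : ¬ SameCycle x a b) (g : ℕ → R) :
    ∏ s ∈ cycleSets (x * swap a b), g #s = g (#(cycleSet x a) + #(cycleSet x b)) *
      ∏ s ∈ ((cycleSets x).erase (cycleSet x a)).erase (cycleSet x b), g #s := by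
  rw [cycleSets_mul_swap h, prod_insert union_notMem_cycleSets, card_cycleSet_union h]

variable {d : ℕ}

theorem cycleSet_mul_swap_pow (hd : 0 < d) (hdc : d < #(cycleSet x a)) :
    cycleSet (x * swap a ((x ^ d) a)) ((x ^ d) a) = (Ioc 0 d).image fun i => (x ^ i) a := by
  have hinj : ∀ i, 0 < i → i < d → (x ^ i) a ≠ a ∧ (x ^ i) a ≠ (x ^ d) a := fun i hi hid =>
    ⟨pow_apply_ne_self hi (by omega), fun e => hid.ne (pow_injOn x a (by simp; omega) (by simpa) e)⟩
  ext u
  rw [mem_cycleSet]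
  constructor
  · refine sameCycle_induction
      (p := fun u => u ∈ (Ioc 0 d).image fun i => (x ^ i) a) ?_ fun w hw => ?_
    · exact mem_image_of_mem (fun i => (x ^ i) a) (mem_Ioc.2 ⟨hd, le_rfl⟩)
    · obtain ⟨i, hi, rfl⟩ := mem_image.1 hw
      rw [mem_Ioc] at hi
      rcases hi.2.eq_or_lt with rfl | h
      · rw [mul_apply, swap_apply_right]
        exact mem_image.2 ⟨1, mem_Ioc.2 ⟨one_pos, hd⟩, by simp⟩
      · obtain ⟨h1, h2⟩ := hinj i hi.1 h
        rw [mul_apply, swap_apply_of_ne_of_ne h1 h2]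
        exact mem_image.2 ⟨i + 1, mem_Ioc.2 ⟨by omega, h⟩, by rw [pow_succ', mul_apply]⟩
  · intro hu
    obtain ⟨i, hi, rfl⟩ := mem_image.1 hu
    rw [mem_Ioc] at hi
    exact sameCycle_mul_swap_pow hinj hi.1 hi.2

theorem card_cycleSet_mul_swap_pow (hd : 0 < d) (hdc : d < #(cycleSet x a)) :
    #(cycleSet (x * swap a ((x ^ d) a)) ((x ^ d) a)) = d := by
  rw [cycleSet_mul_swap_pow hd hdc, card_image_of_injOn, Nat.card_Ioc, Nat.sub_zero]
  refine (pow_injOn x a).mono fun i hi => ?_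
  simp only [coe_Ioc, Set.mem_Ioc, coe_range, Set.mem_Iio] at hi ⊢
  omega

theorem not_sameCycle_mul_swap_pow (hd : 0 < d) (hdc : d < #(cycleSet x a)) :
    ¬ SameCycle (x * swap a ((x ^ d) a)) a ((x ^ d) a) := by
  intro h
  have h1 := mem_cycleSet.2 h.symm
  rw [cycleSet_mul_swap_pow hd hdc] at h1
  obtain ⟨i, hi, h2⟩ := mem_image.1 h1
  rw [mem_Ioc] at hi
  exact pow_apply_ne_self hi.1 (by omega) h2

theorem prod_cycleSets_split (hd : 0 < d) (hdc : d < #(cycleSet x a)) (g : ℕ → R) :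
    ∏ s ∈ cycleSets (x * swap a ((x ^ d) a)), g #s = g (#(cycleSet x a) - d) * g d *
      ∏ s ∈ (cycleSets x).erase (cycleSet x a), g #s := by
  set b := (x ^ d) a with hb
  have h := not_sameCycle_mul_swap_pow hd hdc
  rw [← hb] at h
  have h1 := cycleSet_mul_swap_left h
  have h2 := cycleSets_mul_swap h
  rw [mul_swap_mul_swap] at h1 h2
  have h3 := card_cycleSet_union h
  have h4 := card_cycleSet_mul_swap_pow hd hdc
  rw [← hb] at h4
  rw [← h1, h4] at h3
  rw [← mul_prod_erase _ _ (cycleSet_mem (x * swap a b) a), ← mul_prod_erase _ _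
    (cycleSet_mem_erase h), ← mul_assoc, h4, h3, Nat.add_sub_cancel, h2, h1,
    erase_insert union_notMem_cycleSets]

theorem card_cycleSets_mul_swap_pow (hd : 0 < d) (hdc : d < #(cycleSet x a)) :
    #(cycleSets (x * swap a ((x ^ d) a))) = #(cycleSets x) + 1 := by
  have h := card_cycleSets_mul_swap (not_sameCycle_mul_swap_pow hd hdc)
  rw [mul_swap_mul_swap] at h
  exact h.symm

theorem parts_partition_eq (x : Perm V) :
    x.partition.parts = (cycleSets x).val.map card := by
  have h1 : cycleSets x = (x.cycleFactorsFinset.image support).disjUnion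
      (x.supportᶜ.image singleton) (disjoint_left.2 fun s hs ht => by
        obtain ⟨f, hf, rfl⟩ := mem_image.1 hs
        obtain ⟨a, -, ha⟩ := mem_image.1 ht
        have h := (mem_cycleFactorsFinset_iff.1 hf).1.two_le_card_support
        rw [← ha, card_singleton] at h
        omega) := by
    ext s
    rw [mem_disjUnion, mem_image, mem_image]
    have key : ∀ a ∈ x.support, cycleSet x a = (x.cycleOf a).support := fun a ha => by
      ext u
      rw [mem_cycleSet, mem_support_cycleOf_iff' (mem_support.1 ha)]
    have key' : ∀ a ∈ x.supportᶜ, cycleSet x a = {a} := fun a ha => by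
      ext u
      rw [mem_compl, notMem_support] at ha
      rw [mem_cycleSet, mem_singleton]
      refine ⟨fun h => (h.eq_of_left ha).symm, ?_⟩
      rintro rfl
      exact SameCycle.refl _ _
    constructor
    · intro hs
      obtain ⟨a, -, rfl⟩ := mem_image.1 hs
      by_cases ha : a ∈ x.support
      · exact Or.inl ⟨_, cycleOf_mem_cycleFactorsFinset_iff.2 ha, (key a ha).symm⟩
      · exact Or.inr ⟨a, mem_compl.2 ha, (key' a (mem_compl.2 ha)).symm⟩
    · rintro (⟨f, hf, rfl⟩ | ⟨a, ha, rfl⟩)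
      · obtain ⟨a, ha⟩ := (mem_cycleFactorsFinset_iff.1 hf).1.nonempty_support
        rw [cycle_is_cycleOf ha hf, ← key a (mem_cycleFactorsFinset_support_le hf ha)]
        exact cycleSet_mem x a
      · rw [← key' a ha]
        exact cycleSet_mem x a
  have h2 : Set.InjOn support (x.cycleFactorsFinset : Set (Perm V)) := fun f hf g hg h => by
    obtain ⟨a, ha⟩ := (mem_cycleFactorsFinset_iff.1 hf).1.nonempty_support
    rw [cycle_is_cycleOf ha hf, cycle_is_cycleOf (h ▸ ha) hg]
  rw [parts_partition, cycleType_def, h1, disjUnion_val, Multiset.map_add,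
    image_val_of_injOn h2, image_val_of_injOn (singleton_injective.injOn), Multiset.map_map,
    Multiset.map_map, ← card_compl]
  congr 1
  simp [Multiset.map_const']

end Cycles

section Walk

open Equiv Equiv.Perm

theorem mark_prod {V : Type*} [DecidableEq V] {S : Finset (Finset V)}
    (hS : ∀ s ∈ S, 0 < #s) :
    mark (∏ s ∈ S, MvPolynomial.X (#s - 1)) = ∑ s ∈ S, #s • (Polynomial.C
      (∏ t ∈ S.erase s, MvPolynomial.X (#t - 1)) * Polynomial.X ^ (#s - 1)) := by
  induction S using Finset.induction_on with
  | empty => simp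
  | insert s S hs ih =>
    rw [prod_insert hs, mark_mul, ih fun t ht => hS t (mem_insert_of_mem ht), mark_X,
      sum_insert hs, erase_insert hs, mul_sum, add_comm]
    have h := hS s (mem_insert_self s S)
    congr 1
    · rw [nsmul_eq_mul, ← Nat.cast_add_one, Nat.sub_add_cancel h]
      ring
    · refine sum_congr rfl fun t ht => ?_
      rw [erase_insert_of_ne (ne_of_mem_of_not_mem ht hs).symm,
        prod_insert fun e => hs (mem_of_mem_erase e), Polynomial.C_mul, nsmul_eq_mul, nsmul_eq_mul]
      ring

variable {V : Type*} [Fintype V] [DecidableEq V] {x : Perm V} {a b : V}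

theorem sum_cycleSet {M : Type*} [AddCommMonoid M] {S : Finset (Finset V)}
    (hS : S ⊆ cycleSets x) (F : Finset V → M) :
    ∑ a with cycleSet x a ∈ S, F (cycleSet x a) = ∑ s ∈ S, #s • F s := by
  rw [← sum_fiberwise_of_maps_to (s := univ.filter fun a => cycleSet x a ∈ S) (t := S)
    (g := cycleSet x) fun a ha => (mem_filter.1 ha).2]
  refine sum_congr rfl fun s hs => ?_
  have h : (univ.filter fun a => cycleSet x a ∈ S).filter (fun a => cycleSet x a = s) = s := by
    ext a
    rw [mem_filter, mem_filter]
    refine ⟨?_, fun ha => ?_⟩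
    · rintro ⟨-, rfl⟩
      exact mem_cycleSet_self x a
    · rw [← eq_cycleSet_of_mem (hS hs) ha]
      exact ⟨⟨mem_univ a, hs⟩, rfl⟩
  rw [sum_congr rfl fun a ha => by rw [(mem_filter.1 ha).2], sum_const, h]

/-- The cycle type, as a monomial. -/
noncomputable def cycleMonomial (x : Perm V) : Fock :=
  ∏ s ∈ cycleSets x, MvPolynomial.X (#s - 1)

theorem mark_prod_cycleSets {S : Finset (Finset V)} (hS : S ⊆ cycleSets x) :
    mark (∏ s ∈ S, MvPolynomial.X (#s - 1)) = ∑ a with cycleSet x a ∈ S, Polynomial.C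
      (∏ t ∈ S.erase (cycleSet x a), MvPolynomial.X (#t - 1)) *
        Polynomial.X ^ (#(cycleSet x a) - 1) := by
  rw [sum_cycleSet hS fun s => Polynomial.C (∏ t ∈ S.erase s, MvPolynomial.X (#t - 1)) *
    Polynomial.X ^ (#s - 1)]
  refine mark_prod fun s hs => ?_
  obtain ⟨a, -, rfl⟩ := mem_image.1 (hS hs)
  exact cycleSet_card_pos x a

theorem forget_merge (x : Perm V) (a : V) :
    forget (Polynomial.X ^ (#(cycleSet x a) - 1 + 1) *
      mark (∏ t ∈ (cycleSets x).erase (cycleSet x a), MvPolynomial.X (#t - 1))) =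
    ∑ b with ¬ SameCycle x a b, cycleMonomial (x * swap a b) := by
  rw [mark_prod_cycleSets (erase_subset _ _), mul_sum, map_sum]
  have h : ∀ b, cycleSet x b ∈ (cycleSets x).erase (cycleSet x a) ↔ ¬ SameCycle x a b := fun b =>
    ⟨fun hb h => (mem_erase.1 hb).1 (cycleSet_eq h).symm, cycleSet_mem_erase⟩
  simp only [h]
  refine sum_congr rfl fun b hb => ?_
  rw [cycleMonomial, prod_cycleSets_merge (mem_filter.1 hb).2 fun i => MvPolynomial.X (i - 1),
    mul_left_comm, ← pow_add, forget_mul, forget_X_pow, mul_comm]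
  have h1 := cycleSet_card_pos x a
  have h2 := cycleSet_card_pos x b
  congr 3
  omega

theorem sum_split (x : Perm V) (a : V) :
    (∏ t ∈ (cycleSets x).erase (cycleSet x a), MvPolynomial.X (#t - 1) : Fock) *
      ∑ j ∈ range (#(cycleSet x a) - 1),
        MvPolynomial.X (#(cycleSet x a) - 1 - (j + 1)) * MvPolynomial.X j =
    ∑ b ∈ (cycleSet x a).erase a, cycleMonomial (x * swap a b) := by
  rw [mul_sum]
  refine sum_bij (fun j _ => (x ^ (j + 1)) a) (fun j hj => ?_) (fun i hi j hj h => ?_)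
    (fun b hb => ?_) fun j hj => ?_
  · rw [mem_range] at hj
    rw [mem_erase, mem_cycleSet]
    exact ⟨pow_apply_ne_self (by omega) (by omega), j + 1, by rw [← zpow_natCast]; simp⟩
  · rw [mem_range] at hi hj
    have := pow_injOn x a (by simp; omega) (by simp; omega) h
    omega
  · obtain ⟨hne, hb⟩ := mem_erase.1 hb
    rw [← image_pow_range] at hb
    obtain ⟨i, hi, rfl⟩ := mem_image.1 hb
    rw [mem_range] at hi
    obtain rfl | hi0 := Nat.eq_zero_or_pos i
    · exact absurd rfl hne
    · exact ⟨i - 1, mem_range.2 (by omega), by rw [Nat.sub_add_cancel hi0]⟩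
  · rw [mem_range] at hj
    rw [cycleMonomial, prod_cycleSets_split (by omega) (by omega) fun i => MvPolynomial.X (i - 1),
      mul_comm, Nat.add_sub_cancel, Nat.sub_right_comm]

/-- The weights with which the Hamiltonian moves along a transposition. -/
noncomputable def swapWeight (α : ℝ) (x : Perm V) (a b : V) : ℝ :=
  if SameCycle x a b then 1 else α

theorem ham_cycleMonomial (α β : ℝ) (x : Perm V) : ham α β (cycleMonomial x) =
    (1 / 2 : ℝ) • ∑ a, ((∑ b ∈ univ.erase a, swapWeight α x a b • cycleMonomial (x * swap a b))
      + (β * (#(cycleSet x a) - 1 : ℕ)) • cycleMonomial x) := by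
  have hm : ∀ g : Fock, ham α β g = (1 / 2 : ℝ) • forget (lax α β (mark g)) := fun _ => rfl
  rw [hm, cycleMonomial, mark_prod_cycleSets (Subset.refl _), map_sum, map_sum]
  simp only [cycleSet_mem, filter_true]
  congr 1
  refine sum_congr rfl fun a _ => ?_
  rw [lax_apply, map_add, map_smul, forget_mul, forget_merge, forget_splitPoly, mul_add,
    sum_split, mul_smul_comm, ← add_assoc, prod_erase_mul _ _ (cycleSet_mem x a)]
  congr 1
  have h1 : (univ.erase a).filter (SameCycle x a) = (cycleSet x a).erase a := by
    rw [cycleSet, filter_erase]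
  have h2 : ((univ.erase a).filter fun b => ¬ SameCycle x a b) =
      univ.filter fun b => ¬ SameCycle x a b := by
    rw [filter_erase, erase_eq_of_notMem]
    simp [SameCycle.refl]
  rw [← sum_filter_add_sum_filter_not (univ.erase a) (SameCycle x a), h1, h2, add_comm, smul_sum]
  congr 1
  · refine sum_congr rfl fun b hb => ?_
    rw [swapWeight, if_pos (mem_cycleSet.1 (mem_of_mem_erase hb)), one_smul]
  · refine sum_congr rfl fun b hb => ?_
    rw [swapWeight, if_neg (mem_filter.1 hb).2]

theorem card_filter_swap_eq {σ : Perm V} (hσ : σ.IsSwap) :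
    #{q : V × V | q.1 ≠ q.2 ∧ swap q.1 q.2 = σ} = 2 := by
  obtain ⟨c, d, hcd, rfl⟩ := hσ
  have h : ({q : V × V | q.1 ≠ q.2 ∧ swap q.1 q.2 = swap c d} : Finset _) =
      {(c, d), (d, c)} := by
    ext ⟨a, b⟩
    simp only [mem_filter, mem_univ, true_and, mem_insert, mem_singleton, Prod.mk.injEq]
    constructor
    · rintro ⟨hab, h⟩
      have h1 : ({a, b} : Finset V) = {c, d} := by
        rw [← support_swap hab, ← support_swap hcd, h]
      rw [← Finset.coe_inj] at h1
      push_cast at h1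
      exact Set.pair_eq_pair_iff.1 h1
    · rintro (⟨rfl, rfl⟩ | ⟨rfl, rfl⟩)
      · exact ⟨hcd, rfl⟩
      · exact ⟨hcd.symm, swap_comm _ _⟩
  rw [h, card_pair]
  simp [hcd]

open scoped Classical in
theorem sum_swap {M : Type*} [AddCommMonoid M] (G : Perm V → M) :
    ∑ a, ∑ b ∈ univ.erase a, G (swap a b) = 2 • ∑ σ : Perm V with σ.IsSwap, G σ := by
  rw [sum_sigma', smul_sum]
  have h : ∑ q : V × V with q.1 ≠ q.2, G (swap q.1 q.2) =
      ∑ q ∈ univ.sigma fun a => univ.erase a, G (swap q.1 q.2) :=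
    sum_bij' (fun q _ => ⟨q.1, q.2⟩) (fun q _ => (q.1, q.2)) (by simp [eq_comm])
      (by simp [eq_comm]) (by simp) (by simp) (by simp)
  rw [← h, ← sum_fiberwise_of_maps_to (s := univ.filter fun q : V × V => q.1 ≠ q.2)
    (t := univ.filter fun σ : Perm V => σ.IsSwap) (g := fun q => swap q.1 q.2)
    fun q hq => mem_filter.2 ⟨mem_univ _, q.1, q.2, (mem_filter.1 hq).2, rfl⟩]
  refine sum_congr rfl fun σ hσ => ?_
  rw [sum_congr rfl fun q hq => by rw [(mem_filter.1 hq).2], sum_const, filter_filter,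
    card_filter_swap_eq (mem_filter.1 hσ).2]

theorem evalOne_cycleMonomial (x : Perm V) :
    evalOne (cycleMonomial x) = if x = 1 then 1 else 0 := by
  rw [cycleMonomial, map_prod]
  have hX : ∀ i, evalOne (MvPolynomial.X i) = if i = 0 then 1 else 0 := by simp [evalOne]
  simp only [hX]
  split_ifs with h
  · subst h
    refine prod_eq_one fun s hs => ?_
    obtain ⟨a, -, rfl⟩ := mem_image.1 hs
    simp [cycleSet, filter_eq]
  · obtain ⟨a, ha⟩ : ∃ a, x a ≠ a := by
      by_contra! h1
      exact h (Equiv.ext h1)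
    refine prod_eq_zero (cycleSet_mem x a) (if_neg ?_)
    have h2 : 1 < #(cycleSet x a) := one_lt_card.2 ⟨a, mem_cycleSet_self x a, x a,
      mem_cycleSet.2 (sameCycle_apply_right.2 (SameCycle.refl _ _)), ha.symm⟩
    omega

theorem cycleMonomial_one : cycleMonomial (1 : Perm V) = MvPolynomial.X 0 ^ Fintype.card V := by
  have h : cycleSet (1 : Perm V) = singleton := by
    ext a u
    simp [cycleSet, eq_comm]
  rw [cycleMonomial, cycleSets, h, prod_image singleton_injective.injOn]
  simp

theorem two_mul_nStatConj_partition (x : Perm V) :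
    2 * nStatConj x.partition = ∑ a, (#(cycleSet x a) - 1) := by
  have h := sum_cycleSet (x := x) (Subset.refl _) fun s => #s - 1
  simp only [cycleSet_mem, filter_true] at h
  rw [h, nStatConj_eq, parts_partition_eq, Multiset.map_map, mul_comm, ← Finset.sum_eq_multiset_sum,
    sum_mul]
  refine sum_congr rfl fun s _ => ?_
  rw [Function.comp_apply, Nat.choose_two_right, smul_eq_mul,
    Nat.div_mul_cancel (Nat.even_mul_pred_self _).two_dvd]

end Walk

section Chain

open Equiv Equiv.Perm

variable {α : ℝ} {n : ℕ}

theorem numCycles_eq (x : Perm (Fin n)) : numCycles x = #(cycleSets x) := by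
  rw [numCycles, parts_partition_eq, Multiset.card_map, card_def]

theorem Tmat_mul_swap (hα : 0 < α) (x : Perm (Fin n)) {a b : Fin n} (hab : a ≠ b) :
    Tmat α n x (x * swap a b) = swapWeight α x a b / (α * n.choose 2) := by
  have hs : (x⁻¹ * (x * swap a b)).IsSwap := by
    rw [inv_mul_cancel_left]
    exact ⟨a, b, hab, rfl⟩
  have hne : x * swap a b ≠ x := by simpa [swap_eq_one_iff] using hab
  rw [Tmat, if_neg hne, numCycles_eq, numCycles_eq, swapWeight]
  by_cases h : SameCycle x a b
  · have hb := h
    rw [← mem_cycleSet, ← image_pow_range] at hb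
    obtain ⟨d, hd, rfl⟩ := mem_image.1 hb
    rw [mem_range] at hd
    have hd0 : 0 < d := by
      refine Nat.pos_of_ne_zero ?_
      rintro rfl
      exact hab rfl
    have hc := card_cycleSets_mul_swap_pow hd0 hd
    rw [if_neg (by omega), if_pos ⟨hs, hc⟩, if_pos h]
  · rw [if_pos ⟨hs, card_cycleSets_mul_swap h⟩, if_neg h, div_mul_eq_div_div, div_self hα.ne']

theorem sum_Tmat (hα : 0 < α) (x : Perm (Fin n)) :
    ∑ y, Tmat α n x y • cycleMonomial y =
      (α * n.choose 2)⁻¹ • ham α (α - 1) (cycleMonomial x) := by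
  classical
  have h1 : ∑ y, Tmat α n x y • cycleMonomial y = Tmat α n x x • cycleMonomial x
      + ∑ σ : Perm (Fin n) with σ.IsSwap, Tmat α n x (x * σ) • cycleMonomial (x * σ) := by
    rw [← Equiv.sum_comp (Equiv.mulLeft x), ← add_sum_erase _ _ (mem_univ (1 : Perm (Fin n)))]
    simp only [Equiv.coe_mulLeft, mul_one]
    congr 1
    refine (sum_subset (fun σ hσ => mem_erase.2 ⟨?_, mem_univ _⟩) fun σ h1 h2 => ?_).symm
    · rintro rfl
      exact (mem_filter.1 hσ).2.isCycle.ne_one rfl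
    · have h3 : ¬ σ.IsSwap := fun h => h2 (mem_filter.2 ⟨mem_univ _, h⟩)
      have h4 : x * σ ≠ x := by simpa using (mem_erase.1 h1).1
      rw [Tmat, inv_mul_cancel_left, if_neg h4, if_neg fun h => h3 h.1, if_neg fun h => h3 h.1,
        zero_smul]
  have h2 := sum_swap fun σ => Tmat α n x (x * σ) • cycleMonomial (x * σ)
  rw [two_nsmul, ← two_smul ℝ] at h2
  rw [h1, ham_cycleMonomial, ← inv_smul_smul₀ (two_ne_zero (α := ℝ)) (∑ σ : Perm (Fin n) with _, _),
    ← h2, sum_add_distrib, ← sum_smul, ← mul_sum, ← Nat.cast_sum, ← two_mul_nStatConj_partition,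
    Tmat, if_pos rfl, sum_congr rfl fun a _ => sum_congr rfl fun b hb => by
      rw [Tmat_mul_swap hα x (ne_of_mem_erase hb).symm, div_eq_inv_mul, mul_smul]]
  simp only [← smul_sum]
  push_cast
  module

theorem sum_Tmat_pow (hα : 0 < α) (n r : ℕ) :
    ∑ y, (Tmat α n ^ r) 1 y • cycleMonomial y =
      (α * n.choose 2)⁻¹ ^ r • (ham α (α - 1) ^ r) (MvPolynomial.X 0 ^ n) := by
  induction r with
  | zero => simp [Matrix.one_apply, cycleMonomial_one]
  | succ r ih =>
    rw [pow_succ' (ham _ _), Module.End.mul_apply, pow_succ' (α * (n.choose 2 : ℝ))⁻¹,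
      mul_smul, ← map_smul, ← ih, map_sum, smul_sum]
    simp only [pow_succ, Matrix.mul_apply, sum_smul, mul_smul]
    rw [sum_comm]
    refine sum_congr rfl fun x _ => ?_
    rw [← smul_sum, sum_Tmat hα, map_smul, smul_comm]

end Chain

/-- The return probability of the Metropolis chain after `r` steps equals the `r`-th
moment of `(α n(λ') - n(λ))/(α C(n,2))` under Jack measure (Corollary 1 of the paper). -/
theorem metropolis_return_prob_eq_moment (α : ℝ) (hα : 1 ≤ α) (n : ℕ) (hn : 2 ≤ n)
    (r : ℕ) (hr : 1 ≤ r) :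
    (Tmat α n ^ r) 1 1 =
      ∑ lam : n.Partition, jackP α lam *
        ((α * nStatConj lam - nStat lam) / (α * n.choose 2)) ^ r := by
  have hα0 : 0 < α := by linarith
  have h := congrArg evalOne (sum_Tmat_pow hα0 n r)
  simp only [map_sum, map_smul, evalOne_cycleMonomial, evalOne_ham_pow hα0, smul_eq_mul, mul_ite,
    mul_one, mul_zero, sum_ite_eq', mem_univ, if_true] at h
  rw [h, mul_sum]
  refine sum_congr rfl fun lam _ => ?_
  rw [div_eq_mul_inv, mul_pow]
  ring

end JackTest
end
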